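/- arXiv:math/0606043 — 7 statements merged into one kernel-verified Lean document; each statement's English description precedes it below -/
import Mathlib

section
/- Let W be a finite-dimensional vector space over K = ℚ(ω) with a Hermitian form, and let M ⊆ W be an 𝓔-submodule such that ⟨x,y⟩ ∈ θ·𝓔 for all x, y ∈ M. If r ∈ M satisfies ⟨r,r⟩ = −3, then the triflection R_r maps M into M. -/
/- In `K = ℚ(ω)` (char-zero field generated over ℚ by a primitive cube root of
unity ω, with conjugation σ, θ = ω - σ ω = √-3, Eisenstein integers
𝓔 = {m + n·ω : m, n ∈ ℤ}), with a Hermitian form on a finite-dimensional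
`K`-vector space `W`: if `M` is an 𝓔-submodule of `W` all of whose inner
products lie in θ·𝓔, and `r ∈ M` has `⟨r,r⟩ = -3`, then the triflection
`R_r` maps `M` into `M`. -/
theorem statement3 {K : Type*} [Field K] [CharZero K]
    (ω : K) (hω3 : ω ^ 3 = 1) (hω1 : ω ≠ 1)
    (hgen : Algebra.adjoin ℚ {ω} = ⊤)
    (σ : K →+* K) (hσ2 : ∀ z : K, σ (σ z) = z) (hσω : σ ω = ω ^ 2)
    {W : Type*} [AddCommGroup W] [Module K W] [FiniteDimensional K W]
    (inner : W → W → K)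
    (hadd : ∀ x x' y : W, inner (x + x') y = inner x y + inner x' y)
    (hsmul : ∀ (c : K) (x y : W), inner (c • x) y = c * inner x y)
    (hconj : ∀ x y : W, inner y x = σ (inner x y))
    (M : Set W)
    (hMadd : ∀ x ∈ M, ∀ y ∈ M, x + y ∈ M)
    (hMsmul : ∀ x ∈ M, ∀ m n : ℤ, ((m : K) + (n : K) * ω) • x ∈ M)
    (hMip : ∀ x ∈ M, ∀ y ∈ M, ∃ m n : ℤ,
      inner x y = (ω - σ ω) * ((m : K) + (n : K) * ω))
    (r : W) (hrM : r ∈ M) (hr : inner r r = -3) :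
    ∀ x ∈ M, x - ((1 - ω) * (inner x r / inner r r)) • r ∈ M := by
  intro x hx
  have hω : 1 + ω + ω ^ 2 = 0 := by
    have h : (ω - 1) * (1 + ω + ω ^ 2) = 0 := by linear_combination hω3
    exact (mul_eq_zero.mp h).resolve_left (sub_ne_zero.mpr hω1)
  obtain ⟨m, n, hmn⟩ := hMip x hx r hrM
  have hcoeff : -((1 - ω) * (inner x r / inner r r)) =
      (((m - n : ℤ) : K) + (m : K) * ω) := by
    rw [hmn, hr, hσω]
    push_cast
    field_simp
    linear_combination ((m : K) + n * ω) * (ω - 3) * hω + 3 * (n : K) * hω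
  rw [sub_eq_add_neg, ← neg_smul, hcoeff]
  exact hMadd x hx _ (hMsmul r hrM (m - n) m)
end

section
/- Let W be a finite-dimensional vector space over K = ℚ(ω) with a Hermitian form, and let r, s ∈ W satisfy ⟨r,r⟩ = ⟨s,s⟩ = −3. If ⟨r,s⟩·⟨s,r⟩ = 3 (i.e. the inner product of r and s has absolute norm 3), then the triflections satisfy the braid relation: R_r∘R_s∘R_r = R_s∘R_r∘R_s. -/
/- In `K = ℚ(ω)` (char-zero field generated over ℚ by a primitive cube root of
unity ω, with conjugation σ), with a Hermitian form on a finite-dimensional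
`K`-vector space `W`: if `r, s` have norm `-3` and `⟨r,s⟩·⟨s,r⟩ = 3` (the
inner product of `r` and `s` has absolute norm 3), then the triflections
satisfy the braid relation `R_r ∘ R_s ∘ R_r = R_s ∘ R_r ∘ R_s`. -/
theorem statement5 {K : Type*} [Field K] [CharZero K]
    (ω : K) (hω3 : ω ^ 3 = 1) (hω1 : ω ≠ 1)
    (hgen : Algebra.adjoin ℚ {ω} = ⊤)
    (σ : K →+* K) (hσ2 : ∀ z : K, σ (σ z) = z) (hσω : σ ω = ω ^ 2)
    {W : Type*} [AddCommGroup W] [Module K W] [FiniteDimensional K W]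
    (inner : W → W → K)
    (hadd : ∀ x x' y : W, inner (x + x') y = inner x y + inner x' y)
    (hsmul : ∀ (c : K) (x y : W), inner (c • x) y = c * inner x y)
    (hconj : ∀ x y : W, inner y x = σ (inner x y))
    (r s : W) (hr : inner r r = -3) (hs : inner s s = -3)
    (hrs : inner r s * inner s r = 3) :
    let R : W → W → W := fun t x => x - ((1 - ω) * (inner x t / inner t t)) • t
    R r ∘ R s ∘ R r = R s ∘ R r ∘ R s := by
  intro R
  have hsub (x t y : W) (c : K) : inner (x - c • t) y = inner x y - c * inner t y := by
    rw [sub_eq_add_neg, ← neg_smul, hadd, hsmul]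
    ring
  have hω : 1 + ω + ω ^ 2 = 0 := by
    refine (mul_eq_zero.mp ?_).resolve_left (sub_ne_zero.mpr hω1)
    linear_combination hω3
  funext x
  simp only [Function.comp_apply, R, hsub, hr, hs]
  match_scalars
  · ring
  · linear_combination (inner x r * ((1 - ω) / 3) / 3) * hω +
      (inner x r * ((1 - ω) / 3) ^ 3) * hrs
  · linear_combination -(inner x s * ((1 - ω) / 3) / 3) * hω -
      (inner x s * ((1 - ω) / 3) ^ 3) * hrs
end

section
/- For every pair of distinct vectors r, s among the 16 vectors a, b_i, c_i, d_i, e_i, f_i (i = 1,2,3) whose nodes are joined in the Y₅₅₅ diagram, the inner product satisfies ⟨r,s⟩·⟨s,r⟩ = 3; in particular ⟨r,s⟩ is a unit multiple of θ in 𝓔. -/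
noncomputable section

/- `K = ℚ(ω)` is formalized as a characteristic-zero field generated over `ℚ`
by a primitive cube root of unity `ω`, with complex conjugation `σ` (the ring
involution with `σ ω = ω̄ = ω²`).  Then `θ = ω - ω̄ = ω - ω² = √-3` and
`θ̄ = ω² - ω`.  `V = K^14`. -/

/-- The Hermitian form on `V = K^14` with Gram matrix
`diag(-1,…,-1) ⊕ [[0,θ̄],[θ,0]]` (twelve `-1`s), linear in the first variable
and conjugate-linear in the second:
`⟨x,y⟩ = -∑_{j<12} x_j·σ(y_j) + θ̄·x₁₂·σ(y₁₃) + θ·x₁₃·σ(y₁₂)`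
(0-indexed coordinates), where `θ = ω - ω²`, `θ̄ = ω² - ω`. -/
def innerV {K : Type*} [Field K] (ω : K) (σ : K →+* K) (x y : Fin 14 → K) : K :=
  -(∑ j : Fin 14, if (j : ℕ) < 12 then x j * σ (y j) else 0)
    + (ω ^ 2 - ω) * (x 12 * σ (y 13)) + (ω - ω ^ 2) * (x 13 * σ (y 12))

/-- The 16 vectors `a, bᵢ, cᵢ, dᵢ, eᵢ, fᵢ (i = 1,2,3)` in `𝓔^14 ⊆ V = K^14`,
indexed so that `0 ↦ a`, `1..5 ↦ b₁,c₁,d₁,e₁,f₁`, `6..10 ↦ b₂,…,f₂`,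
`11..15 ↦ b₃,…,f₃`.  Here `ω̄ = ω²`, `θ = ω - ω²`, `θ̄ = ω² - ω`, and the 14
coordinates are three blocks of 4 followed by a block of 2. -/
def Y555vecs {K : Type*} [Field K] (ω : K) : Fin 16 → Fin 14 → K :=
  ![![0, 0, 0, 0,  0, 0, 0, 0,  0, 0, 0, 0,  1, ω ^ 2],
    ![0, 0, 0, ω ^ 2 - ω,  0, 0, 0, 0,  0, 0, 0, 0,  0, 1],
    ![0, 1, 1, 1,  0, 0, 0, 0,  0, 0, 0, 0,  0, 0],
    ![0, ω - ω ^ 2, 0, 0,  0, 0, 0, 0,  0, 0, 0, 0,  0, 0],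
    ![-1, -1, 1, 0,  0, 0, 0, 0,  0, 0, 0, 0,  0, 0],
    ![ω ^ 2 - ω, 0, 0, 0,  0, 0, 0, 0,  0, 0, 0, 0,  0, 0],
    ![0, 0, 0, 0,  0, 0, 0, ω ^ 2 - ω,  0, 0, 0, 0,  0, 1],
    ![0, 0, 0, 0,  0, 1, 1, 1,  0, 0, 0, 0,  0, 0],
    ![0, 0, 0, 0,  0, ω - ω ^ 2, 0, 0,  0, 0, 0, 0,  0, 0],
    ![0, 0, 0, 0,  -1, -1, 1, 0,  0, 0, 0, 0,  0, 0],
    ![0, 0, 0, 0,  ω ^ 2 - ω, 0, 0, 0,  0, 0, 0, 0,  0, 0],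
    ![0, 0, 0, 0,  0, 0, 0, 0,  0, 0, 0, ω ^ 2 - ω,  0, 1],
    ![0, 0, 0, 0,  0, 0, 0, 0,  0, 1, 1, 1,  0, 0],
    ![0, 0, 0, 0,  0, 0, 0, 0,  0, ω - ω ^ 2, 0, 0,  0, 0],
    ![0, 0, 0, 0,  0, 0, 0, 0,  -1, -1, 1, 0,  0, 0],
    ![0, 0, 0, 0,  0, 0, 0, 0,  ω ^ 2 - ω, 0, 0, 0,  0, 0]]

/-- The adjacency ("joined") relation of the `Y₅₅₅` diagram on the 16 nodes
(in the indexing of `Y555vecs`): `a` (node 0) is joined to each `bᵢ`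
(nodes 1, 6, 11), and each chain `bᵢ — cᵢ — dᵢ — eᵢ — fᵢ` consists of
consecutively joined nodes; all other pairs are unjoined. -/
def Y555adj (m n : Fin 16) : Prop :=
  (m = 0 ∧ (n = 1 ∨ n = 6 ∨ n = 11)) ∨ (n = 0 ∧ (m = 1 ∨ m = 6 ∨ m = 11)) ∨
    ((m : ℕ) + 1 = (n : ℕ) ∧ (m : ℕ) % 5 ≠ 0) ∨
    ((n : ℕ) + 1 = (m : ℕ) ∧ (n : ℕ) % 5 ≠ 0)

/-- The set of Eisenstein integers `𝓔 = ℤ[ω] = {m + n·ω : m, n ∈ ℤ}` inside `K`. -/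
def EisensteinSet {K : Type*} [Field K] (ω : K) : Set K :=
  {z | ∃ m n : ℤ, z = (m : K) + (n : K) * ω}

/-- The triflection in a vector `r` of norm `-3`:
`x ↦ x - (1-ω)·(⟨x,r⟩/⟨r,r⟩)·r`. -/
def triflectV {K : Type*} [Field K] (ω : K) (σ : K →+* K) (r : Fin 14 → K) :
    (Fin 14 → K) → (Fin 14 → K) :=
  fun x => x - ((1 - ω) * (innerV ω σ x r / innerV ω σ r r)) • r

/-- The `𝓔`-submodule `L` of `V` spanned by the 16 vectors of `Y555vecs`. -/
def LSet {K : Type*} [Field K] (ω : K) : Set (Fin 14 → K) :=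
  {x | ∃ m n : Fin 16 → ℤ,
    x = ∑ i : Fin 16, (((m i : K) + (n i : K) * ω) • Y555vecs ω i)}

end

/-- Joined vectors of the `Y₅₅₅` diagram have inner products `θ` and `-θ` in the two orders. -/
theorem innerV_Y555vecs_of_adj {K : Type*} [Field K] (ω : K) (hω3 : ω ^ 3 = 1)
    (σ : K →+* K) (hσω : σ ω = ω ^ 2) (m n : Fin 16) (h : Y555adj m n) :
    (innerV ω σ (Y555vecs ω m) (Y555vecs ω n) = ω - ω ^ 2 ∧
        innerV ω σ (Y555vecs ω n) (Y555vecs ω m) = -(ω - ω ^ 2)) ∨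
      (innerV ω σ (Y555vecs ω m) (Y555vecs ω n) = -(ω - ω ^ 2) ∧
        innerV ω σ (Y555vecs ω n) (Y555vecs ω m) = ω - ω ^ 2) := by
  have hω4 : (ω ^ 2) ^ 2 = ω := by linear_combination ω * hω3
  have key : ∀ m n : Fin 16,
      (m = 0 ∧ (n = 1 ∨ n = 6 ∨ n = 11)) ∨ ((m : ℕ) + 1 = (n : ℕ) ∧ (m : ℕ) % 5 ≠ 0) →
      (innerV ω σ (Y555vecs ω m) (Y555vecs ω n) = ω - ω ^ 2 ∧
        innerV ω σ (Y555vecs ω n) (Y555vecs ω m) = -(ω - ω ^ 2)) ∨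
      (innerV ω σ (Y555vecs ω m) (Y555vecs ω n) = -(ω - ω ^ 2) ∧
        innerV ω σ (Y555vecs ω n) (Y555vecs ω m) = ω - ω ^ 2) := by
    rintro m n (⟨rfl, rfl | rfl | rfl⟩ | ⟨hmn, hm⟩)
    · right; simp [innerV, Y555vecs, Fin.sum_univ_succ]
    · right; simp [innerV, Y555vecs, Fin.sum_univ_succ]
    · right; simp [innerV, Y555vecs, Fin.sum_univ_succ]
    · left
      obtain ⟨n, hn⟩ := n
      obtain rfl : (m : ℕ) + 1 = n := hmn
      fin_cases m <;> first
        | exact absurd rfl hm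
        | exact absurd hn (by decide)
        | simp [innerV, Y555vecs, Fin.sum_univ_succ, hσω, hω4]
  rcases h with h | h | h | h
  · exact key m n (Or.inl h)
  · exact (key n m (Or.inl h)).symm.imp And.symm And.symm
  · exact key m n (Or.inr h)
  · exact (key n m (Or.inr h)).symm.imp And.symm And.symm

/-- For every pair of distinct vectors `r, s` among the 16 vectors whose nodes
are joined in the `Y₅₅₅` diagram, `⟨r,s⟩·⟨s,r⟩ = 3`; in particular `⟨r,s⟩` is
a unit multiple of `θ = ω - ω²` in `𝓔` (the units of `𝓔` being
`±1, ±ω, ±ω²`). -/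
theorem statement7 {K : Type*} [Field K] [CharZero K]
    (ω : K) (hω3 : ω ^ 3 = 1) (hω1 : ω ≠ 1)
    (hgen : Algebra.adjoin ℚ {ω} = ⊤)
    (σ : K →+* K) (hσ2 : ∀ z : K, σ (σ z) = z) (hσω : σ ω = ω ^ 2) :
    ∀ m n : Fin 16, m ≠ n → Y555adj m n →
      innerV ω σ (Y555vecs ω m) (Y555vecs ω n)
          * innerV ω σ (Y555vecs ω n) (Y555vecs ω m) = 3 ∧
      ∃ u : K, (u = 1 ∨ u = -1 ∨ u = ω ∨ u = -ω ∨ u = ω ^ 2 ∨ u = -ω ^ 2) ∧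
        innerV ω σ (Y555vecs ω m) (Y555vecs ω n) = u * (ω - ω ^ 2) := by
  intro m n _ hadj
  have hsum : 1 + ω + ω ^ 2 = 0 :=
    (mul_eq_zero.mp (by linear_combination hω3 : (ω - 1) * (1 + ω + ω ^ 2) = 0)).resolve_left
      (sub_ne_zero.mpr hω1)
  have hθ : (ω - ω ^ 2) ^ 2 = -3 := by
    linear_combination (ω - 2) * hω3 + hsum
  rcases innerV_Y555vecs_of_adj ω hω3 σ hσω m n hadj with ⟨h₁, h₂⟩ | ⟨h₁, h₂⟩
  · rw [h₁, h₂]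
    exact ⟨by linear_combination -hθ, 1, by simp, by ring⟩
  · rw [h₁, h₂]
    exact ⟨by linear_combination -hθ, -1, by simp, by ring⟩
end

section
/- Let L be the 𝓔-submodule of V spanned by the 16 vectors a, b_i, c_i, d_i, e_i, f_i (i = 1,2,3). Then L satisfies L = θ·L*: a vector y ∈ V satisfies ⟨x,y⟩ ∈ θ·𝓔 for all x ∈ L if and only if y ∈ L. In particular, all inner products between elements of L are divisible by θ in 𝓔. -/
/-- The Eisenstein integers `ℤ[ω]` as a subring of `K`. -/
def eisensteinSubring {K : Type*} [Field K] (ω : K) (h : ω ^ 2 + ω + 1 = 0) : Subring K where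
  carrier := EisensteinSet ω
  zero_mem' := ⟨0, 0, by simp⟩
  one_mem' := ⟨1, 0, by simp⟩
  add_mem' := by
    rintro _ _ ⟨a, b, rfl⟩ ⟨c, d, rfl⟩
    exact ⟨a + c, b + d, by push_cast; ring⟩
  neg_mem' := by
    rintro _ ⟨a, b, rfl⟩
    exact ⟨-a, -b, by push_cast; ring⟩
  mul_mem' := by
    rintro _ _ ⟨a, b, rfl⟩ ⟨c, d, rfl⟩
    exact ⟨a * c - b * d, a * d + b * c - b * d, by
      push_cast; linear_combination ((b : K) * d) * h⟩

section

variable {K : Type*} [Field K] {ω : K} {σ : K →+* K}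

theorem omega_mem_eisensteinSubring (h : ω ^ 2 + ω + 1 = 0) : ω ∈ eisensteinSubring ω h :=
  ⟨0, 1, by simp⟩

theorem map_mem_eisensteinSubring (h : ω ^ 2 + ω + 1 = 0) (hσω : σ ω = ω ^ 2) {z : K}
    (hz : z ∈ eisensteinSubring ω h) : σ z ∈ eisensteinSubring ω h := by
  obtain ⟨m, n, rfl⟩ := hz
  rw [map_add, map_mul, map_intCast, map_intCast, hσω]
  exact add_mem (intCast_mem _ m)
    (mul_mem (intCast_mem _ n) (pow_mem (omega_mem_eisensteinSubring h) 2))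

theorem mem_LSet_iff (h : ω ^ 2 + ω + 1 = 0) {y : Fin 14 → K} :
    y ∈ LSet ω ↔ ∃ c : Fin 16 → K, (∀ i, c i ∈ eisensteinSubring ω h) ∧
      y = ∑ i, c i • Y555vecs ω i := by
  constructor
  · rintro ⟨m, n, rfl⟩
    exact ⟨fun i => m i + n i * ω, fun i => ⟨m i, n i, rfl⟩, rfl⟩
  · rintro ⟨c, hc, rfl⟩
    choose m n hmn using hc
    exact ⟨m, n, by simp only [hmn]⟩

theorem innerV_sum_smul {ι : Type*} (s : Finset ι) (c : ι → K) (v : ι → Fin 14 → K)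
    (y : Fin 14 → K) :
    innerV ω σ (∑ i ∈ s, c i • v i) y = ∑ i ∈ s, c i * innerV ω σ (v i) y := by
  have hlin : IsLinearMap K (fun x => innerV ω σ x y) :=
    { map_add := fun x z => by
        simp only [innerV, Fin.sum_univ_succ, Pi.add_apply]
        simp
        ring
      map_smul := fun a x => by
        simp only [innerV, Fin.sum_univ_succ, Pi.smul_apply]
        simp
        ring }
  calc innerV ω σ (∑ i ∈ s, c i • v i) y
      = ∑ i ∈ s, innerV ω σ (c i • v i) y :=
        map_sum (IsLinearMap.mk' _ hlin) (fun i => c i • v i) s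
    _ = _ := Finset.sum_congr rfl fun i _ => hlin.map_smul (c i) (v i)

/-- Divisibility by `θ = ω - ω²` in the Eisenstein integers. -/
def ThetaDvd (ω z : K) : Prop :=
  ∃ e ∈ EisensteinSet ω, z = (ω - ω ^ 2) * e

theorem ThetaDvd.add (h : ω ^ 2 + ω + 1 = 0) {z w : K} (hz : ThetaDvd ω z)
    (hw : ThetaDvd ω w) : ThetaDvd ω (z + w) := by
  obtain ⟨e, he, rfl⟩ := hz
  obtain ⟨f, hf, rfl⟩ := hw
  exact ⟨e + f, (eisensteinSubring ω h).add_mem he hf, by ring⟩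

theorem ThetaDvd.mul_left (h : ω ^ 2 + ω + 1 = 0) {c z : K} (hc : c ∈ eisensteinSubring ω h)
    (hz : ThetaDvd ω z) : ThetaDvd ω (c * z) := by
  obtain ⟨e, he, rfl⟩ := hz
  exact ⟨c * e, (eisensteinSubring ω h).mul_mem hc he, by ring⟩

theorem forall_LSet_thetaDvd_iff (h : ω ^ 2 + ω + 1 = 0) (y : Fin 14 → K) :
    (∀ x ∈ LSet ω, ThetaDvd ω (innerV ω σ x y)) ↔
      ∀ i, ThetaDvd ω (innerV ω σ (Y555vecs ω i) y) := by
  constructor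
  · intro hy i
    refine hy _ ((mem_LSet_iff h).2 ⟨Pi.single i 1, fun j => ?_, ?_⟩)
    · rcases eq_or_ne j i with rfl | hj
      · simp
      · simp [hj]
    · simp [Pi.single_apply, ite_smul]
  · intro hy x hx
    obtain ⟨c, hc, rfl⟩ := (mem_LSet_iff h).1 hx
    rw [innerV_sum_smul]
    exact Finset.sum_induction _ (ThetaDvd ω) (fun _ _ => ThetaDvd.add h)
      ⟨0, zero_mem (eisensteinSubring ω h), by simp⟩ fun i _ => (hy i).mul_left h (hc i)

/-- The `ℤ[ω]`-span of `(0,1,1,1)`, `(0,θ,0,0)`, `(-1,-1,1,0)` and `(θ̄,0,0,0)`. -/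
def TetraLattice (ω p q r s : K) : Prop :=
  ∃ α ∈ EisensteinSet ω, ∃ β ∈ EisensteinSet ω, ∃ γ ∈ EisensteinSet ω, ∃ δ ∈ EisensteinSet ω,
    p = -γ + (ω ^ 2 - ω) * δ ∧ q = α + (ω - ω ^ 2) * β - γ ∧ r = α + γ ∧ s = α

/-- `θ`-divisibility of the inner products with `b, c, d, e, f` of a vector with entries
`(p, q, r, s)` in the corresponding block and thirteenth coordinate `u`. -/
def BlockDual (ω : K) (σ : K →+* K) (p q r s u : K) : Prop :=
  ThetaDvd ω (-((ω ^ 2 - ω) * σ s) + (ω - ω ^ 2) * σ u) ∧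
  ThetaDvd ω (-(σ q + σ r + σ s)) ∧
  ThetaDvd ω (-((ω - ω ^ 2) * σ q)) ∧
  ThetaDvd ω (σ p + σ q - σ r) ∧
  ThetaDvd ω (-((ω ^ 2 - ω) * σ p))

theorem blockDual_iff (h : ω ^ 2 + ω + 1 = 0) (hθ : ω - ω ^ 2 ≠ 0)
    (hσ2 : ∀ z : K, σ (σ z) = z) (hσω : σ ω = ω ^ 2) (p q r s u : K) :
    BlockDual ω σ p q r s u ↔ TetraLattice ω p q r s ∧ u ∈ EisensteinSet ω := by
  have hω := omega_mem_eisensteinSubring h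
  have hσmem : ∀ {z}, z ∈ eisensteinSubring ω h → σ z ∈ eisensteinSubring ω h :=
    fun hz => map_mem_eisensteinSubring h hσω hz
  have h2 : (2 : K) ∈ eisensteinSubring ω h := ofNat_mem _ 2
  have hθmem : ω - ω ^ 2 ∈ eisensteinSubring ω h := sub_mem hω (pow_mem hω 2)
  have hθbar : ω ^ 2 - ω = -(ω - ω ^ 2) := by ring
  have hθsq : (ω - ω ^ 2) ^ 2 = -3 := by linear_combination (ω ^ 2 - 3 * ω + 3) * h
  have hσθ : σ (ω - ω ^ 2) = -(ω - ω ^ 2) := by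
    rw [map_sub, map_pow, hσω]; linear_combination (ω - ω ^ 2) * h
  simp only [BlockDual, ThetaDvd, TetraLattice, hθbar]
  generalize ω - ω ^ 2 = θ at *
  constructor
  · rintro ⟨⟨b, hb, eb⟩, ⟨c, hc, ec⟩, ⟨d, hd, ed⟩, ⟨e, he, ee⟩, ⟨f, hf, ef⟩⟩
    have hσp : σ p = f := mul_left_cancel₀ hθ (by linear_combination ef)
    have hσq : σ q = -d := mul_left_cancel₀ hθ (by linear_combination -ed)
    have hσr : σ r = f - d - θ * e := by linear_combination hσp + hσq - ee
    have hσs : σ s = -(θ * c) + 2 * d - f + θ * e := by linear_combination -ec - hσq - hσr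
    have hσu : σ u = b - σ s := mul_left_cancel₀ hθ (by linear_combination eb)
    have hp : p = σ f := by rw [← hσp, hσ2]
    have hq : q = -σ d := by rw [← hσ2 q, hσq, map_neg]
    have hr : r = σ f - σ d + θ * σ e := by
      rw [← hσ2 r, hσr, map_sub, map_sub, map_mul, hσθ]; ring
    have hs : s = θ * σ c + 2 * σ d - σ f - θ * σ e := by
      rw [← hσ2 s, hσs]; simp only [map_add, map_sub, map_neg, map_mul, hσθ, map_ofNat]; ring
    have hu : u = σ b - s := by rw [← hσ2 u, hσu, map_sub, hσ2]
    have hc' := hσmem hc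
    have hd' := hσmem hd
    have he' := hσmem he
    have hf' := hσmem hf
    have hr' : r ∈ eisensteinSubring ω h := by
      rw [hr]; exact add_mem (sub_mem hf' hd') (mul_mem hθmem he')
    have hs' : s ∈ eisensteinSubring ω h := by
      rw [hs]
      exact sub_mem (sub_mem (add_mem (mul_mem hθmem hc') (mul_mem h2 hd')) hf')
        (mul_mem hθmem he')
    refine ⟨⟨s, hs', σ c + θ * s, add_mem hc' (mul_mem hθmem hs'), r - s, sub_mem hr' hs',
      θ * σ f - θ * σ d + σ c - 2 * σ e,
      sub_mem (add_mem (sub_mem (mul_mem hθmem hf') (mul_mem hθmem hd')) hc') (mul_mem h2 he'),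
      ?_, ?_, by ring, rfl⟩, hu ▸ sub_mem (hσmem hb) hs'⟩
    · linear_combination hp + hr - hs + (σ f - σ d) * hθsq
    · linear_combination hq + hr + hs - s * hθsq
  · rintro ⟨⟨α, hα, β, hβ, γ, hγ, δ, hδ, rfl, rfl, rfl, rfl⟩, hu⟩
    have hα' := hσmem hα
    have hβ' := hσmem hβ
    have hγ' := hσmem hγ
    have hδ' := hσmem hδ
    simp only [map_add, map_sub, map_neg, map_mul, hσθ]
    refine ⟨⟨σ s + σ u, add_mem hα' (hσmem hu), by ring⟩,
      ⟨θ * σ s + σ β, add_mem (mul_mem hθmem hα') hβ', ?_⟩,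
      ⟨-(σ s - θ * σ β - σ γ),
        neg_mem (sub_mem (sub_mem hα' (mul_mem hθmem hβ')) hγ'), by ring⟩,
      ⟨θ * σ γ + σ δ - σ β, sub_mem (add_mem (mul_mem hθmem hγ') hδ') hβ', ?_⟩,
      ⟨-σ γ + θ * σ δ, add_mem (neg_mem hγ') (mul_mem hθmem hδ'), by ring⟩⟩
    · linear_combination -σ s * hθsq
    · linear_combination -σ γ * hθsq

theorem mem_LSet_iff_tetraLattice (h : ω ^ 2 + ω + 1 = 0) (y : Fin 14 → K) :
    y ∈ LSet ω ↔ TetraLattice ω (y 0) (y 1) (y 2) (y 3) ∧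
      TetraLattice ω (y 4) (y 5) (y 6) (y 7) ∧ TetraLattice ω (y 8) (y 9) (y 10) (y 11) ∧
      y 12 ∈ EisensteinSet ω ∧ y 13 ∈ EisensteinSet ω := by
  have hω := omega_mem_eisensteinSubring h
  have hω2 := pow_mem hω 2
  have h2 : (2 : K) ∈ eisensteinSubring ω h := ofNat_mem _ 2
  have hθmem : ω - ω ^ 2 ∈ eisensteinSubring ω h := sub_mem hω hω2
  rw [mem_LSet_iff h]
  constructor
  · rintro ⟨c, hc, rfl⟩
    have block : ∀ i j k l m : Fin 16, TetraLattice ω (-c l + (ω ^ 2 - ω) * c m)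
        (c j + (ω - ω ^ 2) * c k - c l) (c j + c l) (c j + (ω ^ 2 - ω) * c i) := by
      intro i j k l m
      refine ⟨c j - (ω - ω ^ 2) * c i, sub_mem (hc j) (mul_mem hθmem (hc i)),
        c k + 2 * c i, add_mem (hc k) (mul_mem h2 (hc i)),
        c l + (ω - ω ^ 2) * c i, add_mem (hc l) (mul_mem hθmem (hc i)),
        c m - c i, sub_mem (hc m) (hc i), ?_, ?_, ?_, ?_⟩ <;> ring
    refine ⟨?_, ?_, ?_, ?_, ?_⟩
    · convert block 1 2 3 4 5 using 1 <;> simp [Fin.sum_univ_succ, Y555vecs] <;> ring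
    · convert block 6 7 8 9 10 using 1 <;> simp [Fin.sum_univ_succ, Y555vecs] <;> ring
    · convert block 11 12 13 14 15 using 1 <;> simp [Fin.sum_univ_succ, Y555vecs] <;> ring
    · change _ ∈ eisensteinSubring ω h
      convert hc 0 using 1
      simp [Fin.sum_univ_succ, Y555vecs]
    · change _ ∈ eisensteinSubring ω h
      convert add_mem (add_mem (add_mem (mul_mem (hc 0) hω2) (hc 1)) (hc 6)) (hc 11) using 1
      simp [Fin.sum_univ_succ, Y555vecs]
      ring
  · rintro ⟨⟨α₁, hα₁, β₁, hβ₁, γ₁, hγ₁, δ₁, hδ₁, h0, h1, h2', h3⟩,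
      ⟨α₂, hα₂, β₂, hβ₂, γ₂, hγ₂, δ₂, hδ₂, h4, h5, h6, h7⟩,
      ⟨α₃, hα₃, β₃, hβ₃, γ₃, hγ₃, δ₃, hδ₃, h8, h9, h10, h11⟩, hu, hv⟩
    obtain ⟨b, hb⟩ : ∃ b, b = y 13 - ω ^ 2 * y 12 := ⟨_, rfl⟩
    have hbmem : b ∈ eisensteinSubring ω h := hb ▸ sub_mem hv (mul_mem hω2 hu)
    have hθb := mul_mem hθmem hbmem
    refine ⟨![y 12, b, α₁ + (ω - ω ^ 2) * b, β₁ - 2 * b, γ₁ - (ω - ω ^ 2) * b, δ₁ + b,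
      0, α₂, β₂, γ₂, δ₂, 0, α₃, β₃, γ₃, δ₃], ?_, ?_⟩
    · have h0mem := zero_mem (eisensteinSubring ω h)
      intro i
      fin_cases i
      exacts [hu, hbmem, add_mem hα₁ hθb, sub_mem hβ₁ (mul_mem h2 hbmem), sub_mem hγ₁ hθb,
        add_mem hδ₁ hbmem, h0mem, hα₂, hβ₂, hγ₂, hδ₂, h0mem, hα₃, hβ₃, hγ₃, hδ₃]
    · ext j
      fin_cases j <;> simp [Fin.sum_univ_succ, Y555vecs]
      · linear_combination h0
      · linear_combination h1
      · linear_combination h2'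
      · linear_combination h3
      · linear_combination h4
      · linear_combination h5
      · linear_combination h6
      · linear_combination h7
      · linear_combination h8
      · linear_combination h9
      · linear_combination h10
      · linear_combination h11
      · linear_combination -hb

theorem forall_thetaDvd_iff_blockDual (y : Fin 14 → K) :
    (∀ i, ThetaDvd ω (innerV ω σ (Y555vecs ω i) y)) ↔
      ThetaDvd ω ((ω ^ 2 - ω) * σ (y 13) + (ω - ω ^ 2) * (ω ^ 2 * σ (y 12))) ∧
      BlockDual ω σ (y 0) (y 1) (y 2) (y 3) (y 12) ∧
      BlockDual ω σ (y 4) (y 5) (y 6) (y 7) (y 12) ∧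
      BlockDual ω σ (y 8) (y 9) (y 10) (y 11) (y 12) := by
  have hcd : ∀ q r s : K, -s + -r + -q = -(q + r + s) := fun q r s => by ring
  have hde : ∀ p q r : K, -r + q + p = p + q - r := fun p q r => by ring
  simp [Fin.forall_fin_succ, innerV, Fin.sum_univ_succ, Y555vecs]
  simp only [BlockDual, hcd, hde, and_assoc, implies_true]

end

/-- `L` (the `𝓔`-span of the 16 vectors) satisfies `L = θ·L*`: a vector
`y ∈ V` satisfies `⟨x,y⟩ ∈ θ·𝓔` for all `x ∈ L` if and only if `y ∈ L`.
In particular all inner products between elements of `L` are divisible by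
`θ = ω - ω²` in `𝓔`. -/
theorem statement11 {K : Type*} [Field K] [CharZero K]
    (ω : K) (hω3 : ω ^ 3 = 1) (hω1 : ω ≠ 1)
    (hgen : Algebra.adjoin ℚ {ω} = ⊤)
    (σ : K →+* K) (hσ2 : ∀ z : K, σ (σ z) = z) (hσω : σ ω = ω ^ 2) :
    (∀ y : Fin 14 → K,
      (∀ x ∈ LSet ω, ∃ e ∈ EisensteinSet ω, innerV ω σ x y = (ω - ω ^ 2) * e)
        ↔ y ∈ LSet ω) ∧
    (∀ x ∈ LSet ω, ∀ y ∈ LSet ω,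
      ∃ e ∈ EisensteinSet ω, innerV ω σ x y = (ω - ω ^ 2) * e) := by
  have h : ω ^ 2 + ω + 1 = 0 := by
    refine (mul_eq_zero.1 ?_).resolve_left (sub_ne_zero.2 hω1)
    linear_combination hω3
  have hθ : ω - ω ^ 2 ≠ 0 := fun h0 => by
    have h3 : (3 : K) = 0 := by
      linear_combination (ω ^ 2 - 3 * ω + 3) * h - (ω - ω ^ 2) * h0
    exact three_ne_zero h3
  have key : ∀ y : Fin 14 → K,
      (∀ x ∈ LSet ω, ThetaDvd ω (innerV ω σ x y)) ↔ y ∈ LSet ω := fun y => by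
    rw [forall_LSet_thetaDvd_iff h, forall_thetaDvd_iff_blockDual, mem_LSet_iff_tetraLattice h]
    simp only [blockDual_iff h hθ hσ2 hσω]
    suffices hy : y 12 ∈ EisensteinSet ω →
        (ThetaDvd ω ((ω ^ 2 - ω) * σ (y 13) + (ω - ω ^ 2) * (ω ^ 2 * σ (y 12))) ↔
          y 13 ∈ EisensteinSet ω) by tauto
    intro hu
    have hu' : ω ^ 2 * σ (y 12) ∈ eisensteinSubring ω h :=
      mul_mem (pow_mem (omega_mem_eisensteinSubring h) 2) (map_mem_eisensteinSubring h hσω hu)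
    constructor
    · rintro ⟨e, he, hey⟩
      have hy13 : σ (y 13) = ω ^ 2 * σ (y 12) - e :=
        mul_left_cancel₀ hθ (by linear_combination -hey)
      rw [← hσ2 (y 13), hy13]
      exact map_mem_eisensteinSubring h hσω (sub_mem hu' he)
    · intro hv
      exact ⟨_, sub_mem hu' (map_mem_eisensteinSubring h hσω hv), by ring⟩
  exact ⟨key, fun x hx y hy => (key y).2 hy x hx⟩
end

section
/- There exist vectors r_p ∈ 𝓔^14 ⊆ V indexed by the 13 points p of the projective plane P²(F₃) and vectors r_l ∈ 𝓔^14 ⊆ V indexed by its 13 lines l, such that: ⟨r_p,r_p⟩ = ⟨r_l,r_l⟩ = −3 for all p and l; ⟨r_p, r_{p'}⟩ = 0 for distinct points p ≠ p'; ⟨r_l, r_{l'}⟩ = 0 for distinct lines l ≠ l'; and ⟨r_p, r_l⟩ = θ if p lies on l, while ⟨r_p, r_l⟩ = 0 if p does not lie on l. -/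
namespace Eisenstein

/-- The ring of Eisenstein integers, on the basis `1, ω` with `ω² = -1 - ω`. -/
abbrev Eis : Type := QuadraticAlgebra ℤ (-1) (-1)

/-- The primitive cube root of unity in the ring of Eisenstein integers. -/
def ω : Eis := ⟨0, 1⟩

/-- The square root `ω - ω²` of `-3` in the ring of Eisenstein integers. -/
def θ : Eis := ⟨1, 2⟩

/-- The form `innerV`, on vectors of Eisenstein integers. -/
def form (x y : Fin 14 → Eis) : Eis :=
  -(∑ j : Fin 14, if (j : ℕ) < 12 then x j * star (y j) else 0)
    + (ω ^ 2 - ω) * (x 12 * star (y 13)) + (ω - ω ^ 2) * (x 13 * star (y 12))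

/-- Representatives of the thirteen points of `P²(F₃)`, normalized to have first nonzero
coordinate `1`. -/
def rep : Fin 13 → Fin 3 → ZMod 3 :=
  ![![0, 0, 1],
    ![0, 1, 0],
    ![0, 1, 1],
    ![0, 1, 2],
    ![1, 0, 0],
    ![1, 0, 1],
    ![1, 0, 2],
    ![1, 1, 0],
    ![1, 1, 1],
    ![1, 1, 2],
    ![1, 2, 0],
    ![1, 2, 1],
    ![1, 2, 2]]

/-- The vector attached to the point of `P²(F₃)` spanned by `rep i`. -/
def pointVec : Fin 13 → Fin 14 → Eis :=
  ![![0, -θ, 0, 0, 0, 0, 0, 0, 0, 0, 0, 0, 0, 0],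
    ![0, 0, 0, -θ, 0, 0, 0, 0, 0, 0, 0, 0, 0, 1],
    ![0, 0, 0, -θ, 0, 0, 0, -θ, 0, 0, θ, -θ, θ, 1 - ω],
    ![0, 0, 0, -θ, 0, 0, θ, -θ, 0, 0, 0, -θ, θ, 1 - ω],
    ![0, 0, θ, -θ, 0, 0, θ, -θ, 0, 0, θ, -θ, θ, 2 - ω],
    ![-θ, 0, 0, 0, 0, 0, 0, 0, 0, 0, 0, 0, 0, 0],
    ![0, 0, θ, -θ, 0, 0, 0, -θ, 0, 0, 0, -θ, θ, 1 - ω],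
    ![0, 0, 0, 0, 0, 0, 0, -θ, 0, 0, 0, 0, 0, 1],
    ![0, 0, 0, 0, 0, 0, 0, 0, 0, -θ, 0, 0, 0, 0],
    ![0, 0, 0, 0, -θ, 0, 0, 0, 0, 0, 0, 0, 0, 0],
    ![0, 0, 0, 0, 0, 0, 0, 0, 0, 0, 0, -θ, 0, 1],
    ![0, 0, 0, 0, 0, -θ, 0, 0, 0, 0, 0, 0, 0, 0],
    ![0, 0, 0, 0, 0, 0, 0, 0, -θ, 0, 0, 0, 0, 0]]

/-- The vector attached to the line of `P²(F₃)` orthogonal to `rep i`. -/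
def lineVec : Fin 13 → Fin 14 → Eis :=
  ![![0, 0, 0, 0, 0, 0, 0, 0, 0, 0, 0, 0, 1, ω],
    ![1, 1, -1, 0, 0, 0, 0, 0, 0, 0, 0, 0, 0, 0],
    ![0, 0, 0, 0, 1, 1, -1, 0, 0, 0, 0, 0, 0, 0],
    ![0, 0, 0, 0, 0, 0, 0, 0, 1, 1, -1, 0, 0, 0],
    ![0, 1, 1, 1, 0, 0, 0, 0, 0, 0, 0, 0, 0, 0],
    ![0, 0, 0, 0, 1, 0, 1, -1, 1, 0, 1, -1, 1, ω ^ 2],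
    ![1, 0, 1, -1, 0, 1, 1, -2, 0, 1, 1, -2, 2, 2 * ω ^ 2],
    ![0, 1, 1, -2, 0, 1, 1, -2, 1, 0, 1, -1, 2, 2 * ω ^ 2],
    ![0, 0, 0, 0, 0, 0, 0, 0, 0, 1, 1, 1, 0, 0],
    ![1, 0, 1, -1, 1, 0, 1, -1, 0, 0, 0, 0, 1, ω ^ 2],
    ![0, 1, 1, -2, 1, 0, 1, -1, 0, 1, 1, -2, 2, 2 * ω ^ 2],
    ![0, 0, 0, 0, 0, 1, 1, 1, 0, 0, 0, 0, 0, 0],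
    ![1, 0, 1, -1, 0, 0, 0, 0, 1, 0, 1, -1, 1, ω ^ 2]]

theorem form_pointVec : ∀ i j, form (pointVec i) (pointVec j) = if i = j then ⟨-3, 0⟩ else 0 := by
  decide +kernel

theorem form_lineVec : ∀ i j, form (lineVec i) (lineVec j) = if i = j then ⟨-3, 0⟩ else 0 := by
  decide +kernel

theorem form_pointVec_lineVec :
    ∀ i j, form (pointVec i) (lineVec j) = if rep j ⬝ᵥ rep i = 0 then ω - ω ^ 2 else 0 := by
  decide +kernel

theorem exists_rep_eq_or_eq_neg :
    ∀ v : Fin 3 → ZMod 3, v ≠ 0 → ∃ i, v = rep i ∨ v = -rep i := by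
  decide +kernel

theorem exists_eq_span_rep (p : Submodule (ZMod 3) (Fin 3 → ZMod 3))
    (hp : Module.finrank (ZMod 3) p = 1) : ∃ i, p = Submodule.span (ZMod 3) {rep i} := by
  have : Fact (Nat.Prime 3) := ⟨Nat.prime_three⟩
  obtain ⟨v, hv, hspan⟩ := finrank_eq_one_iff'.mp hp
  have hpv : p = Submodule.span (ZMod 3) {v.1} := by
    refine le_antisymm (fun x hx => ?_) ((Submodule.span_singleton_le_iff_mem _ _).mpr v.2)
    obtain ⟨c, hc⟩ := hspan ⟨x, hx⟩
    exact Submodule.mem_span_singleton.mpr ⟨c, congrArg Subtype.val hc⟩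
  obtain ⟨i, hi | hi⟩ := exists_rep_eq_or_eq_neg v.1 (by simpa using hv)
  · exact ⟨i, hi ▸ hpv⟩
  · exact ⟨i, by rw [hpv, hi, ← Set.neg_singleton, Submodule.span_neg]⟩

theorem exists_mem_iff_rep_dotProduct_eq_zero (l : Submodule (ZMod 3) (Fin 3 → ZMod 3))
    (hl : Module.finrank (ZMod 3) l = 2) : ∃ i, ∀ v, v ∈ l ↔ rep i ⬝ᵥ v = 0 := by
  have : Fact (Nat.Prime 3) := ⟨Nat.prime_three⟩
  have hann : Module.finrank (ZMod 3) l.dualAnnihilator = 1 := by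
    have := Subspace.finrank_add_finrank_dualAnnihilator_eq l
    simp only [Module.finrank_fin_fun] at this
    omega
  obtain ⟨φ, hφ, hφ'⟩ := finrank_eq_one_iff'.mp hann
  have hmem (v : Fin 3 → ZMod 3) : v ∈ l ↔ φ.1 v = 0 := by
    refine ⟨fun hv => (Submodule.mem_dualAnnihilator _).mp φ.2 v hv, fun hv => ?_⟩
    rw [← Subspace.forall_mem_dualAnnihilator_apply_eq_zero_iff]
    intro ψ hψ
    obtain ⟨c, hc⟩ := hφ' ⟨ψ, hψ⟩
    have : c • φ.1 = ψ := congrArg Subtype.val hc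
    simp [← this, hv]
  obtain ⟨u, hu⟩ := (dotProductEquiv (ZMod 3) (Fin 3)).surjective φ.1
  have hu0 : u ≠ 0 := by
    rintro rfl
    exact hφ (Subtype.ext (by rw [← hu, map_zero]; rfl))
  obtain ⟨i, hi⟩ := exists_rep_eq_or_eq_neg u hu0
  refine ⟨i, fun v => ?_⟩
  rw [hmem, ← hu, dotProductEquiv_apply_apply]
  rcases hi with rfl | rfl <;> simp

section Embedding

variable {K : Type*} [Field K] {w : K}

/-- The ring homomorphism from the Eisenstein integers sending `ω` to `w`. -/
def toField (hw : w * w = (-1 : ℤ) • (1 : K) + (-1 : ℤ) • w) : Eis →+* K :=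
  (QuadraticAlgebra.lift ⟨w, hw⟩ : Eis →ₐ[ℤ] K)

variable (hw : w * w = (-1 : ℤ) • (1 : K) + (-1 : ℤ) • w)

theorem toField_apply (z : Eis) : toField hw z = (z.re : K) + (z.im : K) * w := by
  simp [toField, QuadraticAlgebra.lift]

theorem toField_ω : toField hw ω = w := by
  simp [toField_apply, ω]

theorem toField_star {σ : K →+* K} (hσ : σ w = w ^ 2) (z : Eis) :
    toField hw (star z) = σ (toField hw z) := by
  have hw' : w ^ 2 = -1 - w := by rw [sq, hw]; simp; ring
  simp only [toField_apply, QuadraticAlgebra.re_star, QuadraticAlgebra.im_star, map_add, map_mul,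
    map_intCast, hσ, hw']
  push_cast
  ring

theorem innerV_toField {σ : K →+* K} (hσ : σ w = w ^ 2) (x y : Fin 14 → Eis) :
    innerV w σ (toField hw ∘ x) (toField hw ∘ y) = toField hw (form x y) := by
  simp only [innerV, form, map_add, map_neg, map_mul, map_sub, map_pow, map_sum, apply_ite,
    map_zero, toField_ω, toField_star hw hσ, Function.comp_apply]

end Embedding

end Eisenstein

open Eisenstein in
/-- There are norm `-3` vectors `r_p ∈ 𝓔^14 ⊆ V` indexed by the 13 points
`p` of `P²(F₃)` (the rank-1 subspaces of `F₃³`) and `r_l` indexed by its 13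
lines `l` (the rank-2 subspaces), with all inner products among the `r_p`
zero, all inner products among the `r_l` zero, and `⟨r_p, r_l⟩ = θ` or `0`
according to whether `p` lies on `l` or not. -/
theorem statement13 {K : Type*} [Field K] [CharZero K]
    (ω : K) (hω3 : ω ^ 3 = 1) (hω1 : ω ≠ 1)
    (hgen : Algebra.adjoin ℚ {ω} = ⊤)
    (σ : K →+* K) (hσ2 : ∀ z : K, σ (σ z) = z) (hσω : σ ω = ω ^ 2) :
    ∃ (rp : {p : Submodule (ZMod 3) (Fin 3 → ZMod 3) //
              Module.finrank (ZMod 3) p = 1} → Fin 14 → K)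
      (rl : {l : Submodule (ZMod 3) (Fin 3 → ZMod 3) //
              Module.finrank (ZMod 3) l = 2} → Fin 14 → K),
      (∀ p j, rp p j ∈ EisensteinSet ω) ∧
      (∀ l j, rl l j ∈ EisensteinSet ω) ∧
      (∀ p, innerV ω σ (rp p) (rp p) = -3) ∧
      (∀ l, innerV ω σ (rl l) (rl l) = -3) ∧
      (∀ p p', p ≠ p' → innerV ω σ (rp p) (rp p') = 0) ∧
      (∀ l l', l ≠ l' → innerV ω σ (rl l) (rl l') = 0) ∧
      (∀ p l, (p.1 ≤ l.1 → innerV ω σ (rp p) (rl l) = ω - ω ^ 2) ∧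
              (¬ p.1 ≤ l.1 → innerV ω σ (rp p) (rl l) = 0)) := by
  have hw : ω * ω = (-1 : ℤ) • (1 : K) + (-1 : ℤ) • ω := by
    have : (ω - 1) * (ω * ω + ω + 1) = 0 := by linear_combination hω3
    have := (mul_eq_zero.mp this).resolve_left (sub_ne_zero.mpr hω1)
    simp only [neg_smul, one_smul]
    linear_combination this
  choose i hi using fun p : {p : Submodule (ZMod 3) (Fin 3 → ZMod 3) //
    Module.finrank (ZMod 3) p = 1} => exists_eq_span_rep p.1 p.2
  choose k hk using fun l : {l : Submodule (ZMod 3) (Fin 3 → ZMod 3) //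
    Module.finrank (ZMod 3) l = 2} => exists_mem_iff_rep_dotProduct_eq_zero l.1 l.2
  have hi_inj : Function.Injective i := fun p p' h => Subtype.ext (by rw [hi, hi p', h])
  have hk_inj : Function.Injective k := fun l l' h =>
    Subtype.ext (Submodule.ext fun v => by rw [hk, hk l', h])
  have hinc (p l) : p.1 ≤ l.1 ↔ rep (k l) ⬝ᵥ rep (i p) = 0 := by
    rw [← hk, hi, Submodule.span_singleton_le_iff_mem]
  have hmem (z : Eis) : toField hw z ∈ EisensteinSet ω := ⟨z.re, z.im, toField_apply hw z⟩
  refine ⟨fun p => toField hw ∘ pointVec (i p), fun l => toField hw ∘ lineVec (k l),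
    fun p j => hmem _, fun l j => hmem _, fun p => ?_, fun l => ?_, fun p p' h => ?_,
    fun l l' h => ?_, fun p l => ⟨fun h => ?_, fun h => ?_⟩⟩ <;>
    rw [innerV_toField hw hσω]
  · simp [form_pointVec, toField_apply]
  · simp [form_lineVec, toField_apply]
  · simp [form_pointVec, hi_inj.ne h]
  · simp [form_lineVec, hk_inj.ne h]
  · simp [form_pointVec_lineVec, (hinc p l).mp h, toField_ω]
  · simp [form_pointVec_lineVec, (hinc p l).not.mp h]
end

section
/- Let L be the 𝓔-submodule of V spanned by the 16 vectors a, b_i, c_i, d_i, e_i, f_i (i = 1,2,3). The automorphism group of L acts transitively on roots: for any u, v ∈ L with ⟨u,u⟩ = ⟨v,v⟩ = −3, there exists a K-linear automorphism g of V with ⟨g(x), g(y)⟩ = ⟨x,y⟩ for all x, y ∈ V, g(L) = L, and g(u) = v. -/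
/-! ### Eisenstein integers -/

/-- The ring `ℤ[ω]` as a subalgebra of `K`. -/
abbrev Eis {K : Type*} [Field K] (ω : K) : Subalgebra ℤ K := Algebra.adjoin ℤ {ω}

/-- `θ = ω - ω²`, a square root of `-3`. -/
def theta {K : Type*} [Field K] (ω : K) : K := ω - ω ^ 2

/-- The ideal `θ ℤ[ω]`, as a submodule of `K`. -/
abbrev thetaIdeal {K : Type*} [Field K] (ω : K) : Submodule (Eis ω) K :=
  Submodule.span (Eis ω) {theta ω}

/-- `ω` is a primitive cube root of unity generating `K` over `ℚ`, and `σ` is the corresponding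
complex conjugation. -/
structure IsEisensteinConj {K : Type*} [Field K] [CharZero K] (ω : K) (σ : K →+* K) : Prop where
  sq_omega : ω ^ 2 = -1 - ω
  gen : Algebra.adjoin ℚ {ω} = ⊤
  map_map : ∀ z, σ (σ z) = z
  map_omega : σ ω = ω ^ 2

theorem smul_mem_of_mem_eis {K V : Type*} [Field K] [AddCommGroup V] [Module K V] {ω : K}
    (L : Submodule (Eis ω) V) {e : K} (he : e ∈ Eis ω) {x : V} (hx : x ∈ L) : e • x ∈ L :=
  L.smul_mem (⟨e, he⟩ : Eis ω) hx

section Eisenstein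

variable {K : Type*} [Field K] {ω : K}

theorem mem_thetaIdeal {a : K} : a ∈ thetaIdeal ω ↔ ∃ e ∈ Eis ω, a = e * theta ω := by
  rw [Submodule.mem_span_singleton]
  constructor
  · rintro ⟨e, rfl⟩
    exact ⟨e, e.2, rfl⟩
  · rintro ⟨e, he, rfl⟩
    exact ⟨⟨e, he⟩, rfl⟩

theorem mul_mem_thetaIdeal {e a : K} (he : e ∈ Eis ω) (ha : a ∈ thetaIdeal ω) :
    e * a ∈ thetaIdeal ω :=
  smul_mem_of_mem_eis _ he ha

theorem mul_theta_mem {e : K} (he : e ∈ Eis ω) : e * theta ω ∈ thetaIdeal ω :=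
  mem_thetaIdeal.2 ⟨e, he, rfl⟩

theorem theta_mem_thetaIdeal : theta ω ∈ thetaIdeal ω := Submodule.mem_span_singleton_self _

theorem omega_mem : ω ∈ Eis ω := Algebra.self_mem_adjoin_singleton ℤ ω

theorem theta_mem : theta ω ∈ Eis ω := sub_mem omega_mem (pow_mem omega_mem 2)

variable [CharZero K] {σ : K →+* K}

namespace IsEisensteinConj

theorem mem_eis_iff (h : IsEisensteinConj ω σ) {a : K} :
    a ∈ Eis ω ↔ ∃ m n : ℤ, a = m + n * ω := by
  constructor
  · intro ha
    induction ha using Algebra.adjoin_induction with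
    | mem x hx => exact ⟨0, 1, by simp_all⟩
    | algebraMap r => exact ⟨r, 0, by simp⟩
    | add x y _ _ hx hy =>
      obtain ⟨m, n, rfl⟩ := hx
      obtain ⟨m', n', rfl⟩ := hy
      exact ⟨m + m', n + n', by push_cast; ring⟩
    | mul x y _ _ hx hy =>
      obtain ⟨m, n, rfl⟩ := hx
      obtain ⟨m', n', rfl⟩ := hy
      refine ⟨m * m' - n * n', m * n' + n * m' - n * n', ?_⟩
      push_cast
      linear_combination (n : K) * n' * h.sq_omega
  · rintro ⟨m, n, rfl⟩
    exact add_mem (intCast_mem _ _) (mul_mem (intCast_mem _ _) omega_mem)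

theorem theta_eq (h : IsEisensteinConj ω σ) : theta ω = 1 + 2 * ω := by
  rw [theta, h.sq_omega]; ring

theorem theta_mul_self (h : IsEisensteinConj ω σ) : theta ω * theta ω = -3 := by
  rw [h.theta_eq]; linear_combination 4 * h.sq_omega

theorem theta_ne_zero (h : IsEisensteinConj ω σ) : theta ω ≠ 0 := by
  intro h0
  have := h.theta_mul_self
  rw [h0] at this
  norm_num at this

theorem map_theta (h : IsEisensteinConj ω σ) : σ (theta ω) = -theta ω := by
  rw [h.theta_eq, map_add, map_mul, h.map_omega, h.sq_omega, map_one, map_ofNat]; ring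

theorem map_mem (h : IsEisensteinConj ω σ) {a : K} (ha : a ∈ Eis ω) : σ a ∈ Eis ω := by
  obtain ⟨m, n, rfl⟩ := h.mem_eis_iff.1 ha
  rw [map_add, map_mul, map_intCast, map_intCast, h.map_omega]
  exact add_mem (intCast_mem _ _) (mul_mem (intCast_mem _ _) (pow_mem omega_mem 2))

theorem map_mem_thetaIdeal (h : IsEisensteinConj ω σ) {a : K} (ha : a ∈ thetaIdeal ω) :
    σ a ∈ thetaIdeal ω := by
  obtain ⟨e, he, rfl⟩ := mem_thetaIdeal.1 ha
  exact mem_thetaIdeal.2 ⟨-σ e, neg_mem (h.map_mem he), by rw [map_mul, h.map_theta]; ring⟩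

theorem map_mem_thetaIdeal_iff (h : IsEisensteinConj ω σ) {a : K} :
    σ a ∈ thetaIdeal ω ↔ a ∈ thetaIdeal ω :=
  ⟨fun ha => h.map_map a ▸ h.map_mem_thetaIdeal ha, h.map_mem_thetaIdeal⟩

theorem omega_notMem_range (h : IsEisensteinConj ω σ) (q : ℚ) : ω ≠ q := by
  rintro rfl
  have h1 := h.map_theta
  rw [h.theta_eq, map_add, map_mul, map_one, map_ofNat, map_ratCast, ← h.theta_eq] at h1
  exact h.theta_ne_zero (by linear_combination h1 / 2)

/-- Coordinates with respect to the basis `1, ω` are unique. -/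
theorem coord_eq_zero (h : IsEisensteinConj ω σ) {m n : ℤ} (hmn : (m : K) + n * ω = 0) :
    m = 0 ∧ n = 0 := by
  have hn : n = 0 := by
    by_contra hn
    have hn' : (n : K) ≠ 0 := by exact_mod_cast hn
    apply h.omega_notMem_range (-m / n : ℚ)
    push_cast
    field_simp
    linear_combination hmn
  subst hn
  simpa using hmn

theorem eq_three_mul_of_map_eq (h : IsEisensteinConj ω σ) {a : K} (ha : a ∈ thetaIdeal ω)
    (hσ : σ a = a) : ∃ k : ℤ, a = 3 * k := by
  obtain ⟨e, he, rfl⟩ := mem_thetaIdeal.1 ha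
  obtain ⟨m, n, rfl⟩ := h.mem_eis_iff.1 he
  have key : ((n - 2 * m : ℤ) : K) + ((2 * n - 4 * m : ℤ) : K) * ω = 0 := by
    simp only [map_mul, map_add, map_intCast, h.map_omega, h.map_theta, h.sq_omega] at hσ
    rw [h.theta_eq] at hσ
    push_cast
    linear_combination hσ
  obtain ⟨h1, -⟩ := h.coord_eq_zero key
  obtain rfl : n = 2 * m := by omega
  refine ⟨-m, ?_⟩
  have := h.theta_mul_self
  rw [h.theta_eq] at this ⊢
  push_cast
  linear_combination m * this

theorem three_mem_thetaIdeal (h : IsEisensteinConj ω σ) : (3 : K) ∈ thetaIdeal ω :=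
  mem_thetaIdeal.2 ⟨-theta ω, neg_mem theta_mem, by linear_combination h.theta_mul_self⟩

theorem one_notMem_thetaIdeal (h : IsEisensteinConj ω σ) : (1 : K) ∉ thetaIdeal ω := by
  intro h1
  obtain ⟨k, hk⟩ := h.eq_three_mul_of_map_eq h1 (map_one σ)
  have : (1 : ℤ) = 3 * k := by exact_mod_cast hk
  omega

/-- The residue field of `θ` is `𝔽₃`. -/
theorem exists_residue (h : IsEisensteinConj ω σ) {a : K} (ha : a ∈ Eis ω) :
    a ∈ thetaIdeal ω ∨ a - 1 ∈ thetaIdeal ω ∨ a + 1 ∈ thetaIdeal ω := by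
  obtain ⟨m, n, rfl⟩ := h.mem_eis_iff.1 ha
  have key (j k : ℤ) (hj : m + n = j + 3 * k) : (m : K) + n * ω - j ∈ thetaIdeal ω := by
    have h1 : ω - 1 ∈ thetaIdeal ω := mem_thetaIdeal.2 ⟨1 + ω, add_mem (one_mem _) omega_mem, by
      rw [h.theta_eq]; linear_combination -2 * h.sq_omega⟩
    have h2 : (m : K) + n * ω - j = n * (ω - 1) + k * 3 := by
      have : (m : K) + n = j + 3 * k := by exact_mod_cast hj
      linear_combination this
    rw [h2]
    exact add_mem (mul_mem_thetaIdeal (intCast_mem _ _) h1)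
      (mul_mem_thetaIdeal (intCast_mem _ _) h.three_mem_thetaIdeal)
  have hm := Int.emod_add_mul_ediv (m + n) 3
  have : (m + n) % 3 = 0 ∨ (m + n) % 3 = 1 ∨ (m + n) % 3 = 2 := by omega
  rcases this with h3 | h3 | h3
  · exact Or.inl (by simpa using key 0 ((m + n) / 3) (by omega))
  · exact Or.inr (Or.inl (by simpa using key 1 ((m + n) / 3) (by omega)))
  · exact Or.inr (Or.inr (by simpa using key (-1) ((m + n) / 3 + 1) (by omega)))

theorem mem_thetaIdeal_of_mul_mem (h : IsEisensteinConj ω σ) {a b : K} (ha : a ∈ Eis ω)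
    (hb : b ∈ Eis ω) (hab : a * b ∈ thetaIdeal ω) : a ∈ thetaIdeal ω ∨ b ∈ thetaIdeal ω := by
  rcases h.exists_residue ha with h1 | h1 | h1
  · exact Or.inl h1
  · right
    have := sub_mem hab (mul_mem_thetaIdeal hb h1)
    rwa [show a * b - b * (a - 1) = b by ring] at this
  · right
    have := sub_mem (mul_mem_thetaIdeal hb h1) hab
    rwa [show b * (a + 1) - a * b = b by ring] at this

theorem isPrincipalIdealRing (h : IsEisensteinConj ω σ) : IsPrincipalIdealRing (Eis ω) := by
  have hcube : ω ^ 3 = 1 := by linear_combination (ω - 1) * h.sq_omega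
  have hω : IsPrimitiveRoot ω 3 := by
    refine IsPrimitiveRoot.iff_orderOf.2 (orderOf_eq_prime hcube ?_)
    rintro rfl
    exact h.omega_notMem_range 1 (by simp)
  have : IsCyclotomicExtension {3} ℚ K := by
    refine (IsCyclotomicExtension.iff_singleton 3 ℚ K).2 ⟨⟨ω, hω⟩, fun x => ?_⟩
    have hx : x ∈ Algebra.adjoin ℚ {ω} := h.gen ▸ Algebra.mem_top
    exact Algebra.adjoin_mono (by simpa using hcube) hx
  have : NumberField K := IsCyclotomicExtension.numberField {3} ℚ K
  have := IsCyclotomicExtension.Rat.three_pid K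
  exact IsPrincipalIdealRing.of_surjective
    hω.adjoinEquivRingOfIntegers.symm
    hω.adjoinEquivRingOfIntegers.symm.surjective

theorem exists_mul_mem (h : IsEisensteinConj ω σ) (x : K) : ∃ d ∈ Eis ω, d ≠ 0 ∧ d * x ∈ Eis ω := by
  have hx : x ∈ Algebra.adjoin ℚ {ω} := h.gen ▸ Algebra.mem_top
  induction hx using Algebra.adjoin_induction with
  | mem x hx => exact ⟨1, one_mem _, one_ne_zero, by simp_all⟩
  | algebraMap r =>
    refine ⟨r.den, natCast_mem _ _, by simp, ?_⟩
    have : (r.den : K) * algebraMap ℚ K r = r.num := by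
      rw [eq_ratCast]; exact_mod_cast r.den_mul_eq_num
    exact this ▸ intCast_mem _ _
  | add x y _ _ hx hy =>
    obtain ⟨d, hd, hd0, hdx⟩ := hx
    obtain ⟨e, he, he0, hey⟩ := hy
    refine ⟨d * e, mul_mem hd he, mul_ne_zero hd0 he0, ?_⟩
    rw [show d * e * (x + y) = e * (d * x) + d * (e * y) by ring]
    exact add_mem (mul_mem he hdx) (mul_mem hd hey)
  | mul x y _ _ hx hy =>
    obtain ⟨d, hd, hd0, hdx⟩ := hx
    obtain ⟨e, he, he0, hey⟩ := hy
    refine ⟨d * e, mul_mem hd he, mul_ne_zero hd0 he0, ?_⟩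
    rw [show d * e * (x * y) = (d * x) * (e * y) by ring]
    exact mul_mem hdx hey

theorem inv_three_notMem (h : IsEisensteinConj ω σ) : (3 : K)⁻¹ ∉ Eis ω := by
  intro h3
  have := mul_mem_thetaIdeal h3 h.three_mem_thetaIdeal
  rw [inv_mul_cancel₀ (by norm_num)] at this
  exact h.one_notMem_thetaIdeal this

/-- A proper ideal of `ℤ[ω]` is contained in a prime principal ideal. -/
theorem exists_prime_of_one_notMem (h : IsEisensteinConj ω σ) {I : Submodule (Eis ω) K}
    (hI : ∀ a ∈ I, a ∈ Eis ω) (h1 : (1 : K) ∉ I) :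
    ∃ p : Eis ω, Prime p ∧ ∀ a ∈ I, ∃ e ∈ Eis ω, a = e * p := by
  have := h.isPrincipalIdealRing
  let J : Ideal (Eis ω) := I.comap (Algebra.linearMap (Eis ω) K)
  have hJ : J ≠ ⊤ := by
    rw [Ne, Ideal.eq_top_iff_one]
    simpa [J] using h1
  obtain ⟨M, hM, hJM⟩ := Ideal.exists_le_maximal J hJ
  have hfield : ¬ IsField (Eis ω) := by
    intro hf
    obtain ⟨b, hb⟩ := hf.mul_inv_cancel (a := 3) (by
      intro h0
      have := congrArg (Subtype.val) h0
      norm_num at this)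
    have hb' : (3 : K) * b = 1 := congrArg Subtype.val hb
    exact h.inv_three_notMem (by rw [inv_eq_of_mul_eq_one_right hb']; exact b.2)
  have hM0 : M ≠ ⊥ := Ring.ne_bot_of_isMaximal_of_not_isField hM hfield
  have := hM.isPrime
  refine ⟨_, Submodule.IsPrincipal.prime_generator_of_isPrime M hM0, fun a ha => ?_⟩
  obtain ⟨c, hc⟩ := (Submodule.IsPrincipal.mem_iff_eq_smul_generator M).1
    (hJM (show (⟨a, hI a ha⟩ : Eis ω) ∈ J from ha))
  exact ⟨c, c.2, congrArg Subtype.val hc⟩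

end IsEisensteinConj

end Eisenstein

/-! ### Modular Hermitian lattices -/

section Hermitian

variable {K V : Type*} [Field K] {ω : K} {σ : K →+* K} [AddCommGroup V] [Module K V]

/-- A nondegenerate sesquilinear form that is Hermitian with respect to `σ`. -/
structure IsNondegHermitian (B : V →ₗ[K] V →ₛₗ[σ] K) : Prop where
  conj : ∀ x y, σ (B x y) = B y x
  eq_zero : ∀ x, (∀ y, B x y = 0) → x = 0

/-- A full `ℤ[ω]`-lattice that equals `θ` times its dual. -/
structure IsThetaModular (B : V →ₗ[K] V →ₛₗ[σ] K) (L : Submodule (Eis ω) V) : Prop where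
  mem_iff : ∀ x, x ∈ L ↔ ∀ l ∈ L, B x l ∈ thetaIdeal ω
  full : ∀ x, ∃ d ∈ Eis ω, d ≠ 0 ∧ d • x ∈ L

/-- Two lattices are related by an isometry fixing `v`. -/
def LatticeEquiv (B : V →ₗ[K] V →ₛₗ[σ] K) (v : V) (L M : Submodule (Eis ω) V) : Prop :=
  ∃ g : V ≃ₗ[K] V, (∀ x y, B (g x) (g y) = B x y) ∧ g v = v ∧ ∀ x, g x ∈ M ↔ x ∈ L

/-- The image of a lattice under a linear automorphism. -/
def mapLattice (g : V ≃ₗ[K] V) (L : Submodule (Eis ω) V) : Submodule (Eis ω) V :=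
  L.comap (g.symm.toLinearMap.restrictScalars (Eis ω))

theorem mem_mapLattice {g : V ≃ₗ[K] V} {L : Submodule (Eis ω) V} {x : V} :
    x ∈ mapLattice g L ↔ g.symm x ∈ L := Iff.rfl

@[simp]
theorem apply_mem_mapLattice {g : V ≃ₗ[K] V} {L : Submodule (Eis ω) V} {x : V} :
    g x ∈ mapLattice g L ↔ x ∈ L := by
  rw [mem_mapLattice, g.symm_apply_apply]

theorem LatticeEquiv.trans {B : V →ₗ[K] V →ₛₗ[σ] K} {v : V} {L M N : Submodule (Eis ω) V}
    (h₁ : LatticeEquiv B v L M) (h₂ : LatticeEquiv B v M N) : LatticeEquiv B v L N := by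
  obtain ⟨g, hg, hgv, hgm⟩ := h₁
  obtain ⟨g', hg', hgv', hgm'⟩ := h₂
  exact ⟨g.trans g', fun x y => by simp [hg, hg'], by simp [hgv, hgv'], fun x => by
    simp [hgm, hgm']⟩

theorem latticeEquiv_mapLattice {B : V →ₗ[K] V →ₛₗ[σ] K} {v : V} (L : Submodule (Eis ω) V)
    {g : V ≃ₗ[K] V} (hg : ∀ x y, B (g x) (g y) = B x y) (hgv : g v = v) :
    LatticeEquiv B v L (mapLattice g L) :=
  ⟨g, hg, hgv, fun _ => apply_mem_mapLattice⟩

theorem LatticeEquiv.refl (B : V →ₗ[K] V →ₛₗ[σ] K) (v : V) (L : Submodule (Eis ω) V) :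
    LatticeEquiv B v L L :=
  ⟨LinearEquiv.refl K V, fun _ _ => rfl, rfl, fun _ => Iff.rfl⟩

namespace IsThetaModular

variable {B : V →ₗ[K] V →ₛₗ[σ] K} {L M : Submodule (Eis ω) V}

theorem apply_mem (hL : IsThetaModular B L) {x y : V} (hx : x ∈ L) (hy : y ∈ L) :
    B x y ∈ thetaIdeal ω :=
  (hL.mem_iff x).1 hx y hy

theorem map (hL : IsThetaModular B L) {g : V ≃ₗ[K] V}
    (hg : ∀ x y, B (g x) (g y) = B x y) : IsThetaModular B (mapLattice g L) where
  mem_iff x := by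
    obtain ⟨x, rfl⟩ := g.surjective x
    rw [apply_mem_mapLattice, hL.mem_iff]
    constructor
    · intro hx l hl
      obtain ⟨l, rfl⟩ := g.surjective l
      rw [hg]
      exact hx l (apply_mem_mapLattice.1 hl)
    · intro hx l hl
      rw [← hg]
      exact hx (g l) (apply_mem_mapLattice.2 hl)
  full x := by
    obtain ⟨d, hd, hd0, hdx⟩ := hL.full (g.symm x)
    exact ⟨d, hd, hd0, by rwa [mem_mapLattice, map_smul]⟩

/-- A modular lattice is maximal among lattices on which the form is `θ`-integral. -/
theorem eq_of_le (hL : IsThetaModular B L) (hM : IsThetaModular B M) (hle : L ≤ M) :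
    L = M :=
  le_antisymm hle fun x hx => (hL.mem_iff x).2 fun _ hl => hM.apply_mem hx (hle hl)

/-- Modular lattices with the same root agree as soon as the vectors orthogonal to the root and one
vector of minimal pairing with the root do. -/
theorem eq_of_orthogonal_le (hL : IsThetaModular B L) (hM : IsThetaModular B M) {v : V} (hv : v ∈ L)
    (hle : ∀ x ∈ L, B x v = 0 → x ∈ M) {l : V} (hl : l ∈ L) (hlM : l ∈ M)
    (hlv : B l v = theta ω) : L = M := by
  refine hL.eq_of_le hM fun x hx => ?_
  obtain ⟨e, he, hxe⟩ := mem_thetaIdeal.1 (hL.apply_mem hx hv)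
  rw [← sub_add_cancel x (e • l)]
  exact add_mem (hle _ (sub_mem hx (smul_mem_of_mem_eis L he hl)) (by simp [hxe, hlv]))
    (smul_mem_of_mem_eis M he hlM)

end IsThetaModular

namespace IsNondegHermitian

variable {B : V →ₗ[K] V →ₛₗ[σ] K}

theorem eq_zero_symm (hB : IsNondegHermitian B) {x y : V} (h : B x y = 0) : B y x = 0 := by
  rw [← hB.conj, h, map_zero]

theorem exists_equiv [FiniteDimensional K V] (hB : IsNondegHermitian B) (f : V →ₗ[K] V)
    (hf : ∀ x y, B (f x) (f y) = B x y) : ∃ g : V ≃ₗ[K] V, ∀ x, g x = f x := by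
  have hinj : Function.Injective f := by
    rw [injective_iff_map_eq_zero]
    intro x hx
    exact hB.eq_zero x fun y => by rw [← hf, hx, map_zero, LinearMap.zero_apply]
  exact ⟨LinearEquiv.ofInjectiveEndo f hinj, fun x => rfl⟩

/-- A unitary reflection carrying `a` to `b` and fixing everything orthogonal to `a - b`. -/
theorem exists_reflection [FiniteDimensional K V] (hB : IsNondegHermitian B) {a b : V}
    (hab : B a a = B b b) (hne : B a (a - b) ≠ 0) :
    ∃ g : V ≃ₗ[K] V, (∀ x y, B (g x) (g y) = B x y) ∧ g a = b ∧
      ∀ x, B x (a - b) = 0 → g x = x := by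
  set r := a - b with hr
  let f : V →ₗ[K] V := LinearMap.id - ((B a r)⁻¹ • B.flip r).smulRight r
  have hfx (x : V) : f x = x - ((B a r)⁻¹ * B x r) • r := by simp [f]
  have hrr : B r r = B a r + B r a := by
    rw [hr]; simp only [map_sub, LinearMap.sub_apply]; rw [hab]; ring
  have hne' : B r a ≠ 0 := fun h0 => hne (hB.eq_zero_symm h0)
  have hf (x y : V) : B (f x) (f y) = B x y := by
    rw [hfx, hfx]
    simp only [map_sub, map_smul, LinearMap.sub_apply, LinearMap.smul_apply, map_smulₛₗ, map_mul,
      map_inv₀, hB.conj, hrr, smul_eq_mul]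
    field_simp
    ring
  obtain ⟨g, hg⟩ := hB.exists_equiv f hf
  refine ⟨g, fun x y => by rw [hg, hg, hf], ?_, fun x hx => ?_⟩
  · rw [hg, hfx, inv_mul_cancel₀ hne, one_smul, hr, sub_sub_cancel]
  · rw [hg, hfx, hx, mul_zero, zero_smul, sub_zero]

theorem exists_isometry [FiniteDimensional K V] (hB : IsNondegHermitian B) {a b : V}
    (hab : B a a = B b b) (hne : B a (a + b) ≠ 0) :
    ∃ g : V ≃ₗ[K] V, (∀ x y, B (g x) (g y) = B x y) ∧ g a = b ∧
      ∀ x, B x (a + b) = 0 → g x = -x := by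
  obtain ⟨g, hg, hga, hgfix⟩ := hB.exists_reflection (a := a) (b := -b) (by simpa using hab)
    (by rwa [sub_neg_eq_add])
  refine ⟨g.trans (LinearEquiv.neg K), fun x y => by simp [hg], by simp [hga], fun x hx => ?_⟩
  simp [hgfix x (by rwa [sub_neg_eq_add])]

end IsNondegHermitian


theorem not_prime_of_mul_eq_one {p : Eis ω} (hp : Prime p) {e : K} (he : e ∈ Eis ω)
    (h1 : e * p = 1) : False :=
  hp.not_isUnit (IsUnit.of_mul_eq_one_right (⟨e, he⟩ : Eis ω) (Subtype.ext h1))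

variable [CharZero K]

namespace IsThetaModular

variable {B : V →ₗ[K] V →ₛₗ[σ] K} {L M : Submodule (Eis ω) V}

theorem apply_mem_iff (hB : IsNondegHermitian B) (hσ : IsEisensteinConj ω σ) {x y : V} :
    B x y ∈ thetaIdeal ω ↔ B y x ∈ thetaIdeal ω := by
  rw [← hB.conj, hσ.map_mem_thetaIdeal_iff]

theorem exists_norm_eq (hL : IsThetaModular B L) (hB : IsNondegHermitian B)
    (hσ : IsEisensteinConj ω σ) {x : V} (hx : x ∈ L) : ∃ k : ℤ, B x x = 3 * k :=
  hσ.eq_three_mul_of_map_eq (hL.apply_mem hx hx) (hB.conj x x)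

end IsThetaModular

/-- A `θ`-integral functional either takes the value `θ` or is divisible by a prime times `θ`. -/
theorem exists_eq_theta_or_exists_prime (hσ : IsEisensteinConj ω σ) {S : Submodule (Eis ω) V}
    (f : V →ₗ[K] K) (hf : ∀ s ∈ S, f s ∈ thetaIdeal ω) :
    (∃ s ∈ S, f s = theta ω) ∨
      ∃ p : Eis ω, Prime p ∧ ∀ s ∈ S, ∃ e ∈ Eis ω, f s = e * (p * theta ω) := by
  have hθ := hσ.theta_ne_zero
  let I : Submodule (Eis ω) K := S.map (((theta ω)⁻¹ • f).restrictScalars (Eis ω))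
  have hI : ∀ a ∈ I, a ∈ Eis ω := by
    rintro _ ⟨s, hs, rfl⟩
    obtain ⟨e, he, hse⟩ := mem_thetaIdeal.1 (hf s hs)
    have : (theta ω)⁻¹ * f s = e := by rw [hse]; field_simp
    simpa [this] using he
  by_cases h1 : (1 : K) ∈ I
  · left
    obtain ⟨s, hs, hs1⟩ := h1
    refine ⟨s, hs, ?_⟩
    have hs1 : (theta ω)⁻¹ * f s = 1 := hs1
    field_simp at hs1
    exact hs1
  · right
    obtain ⟨p, hp, hdiv⟩ := hσ.exists_prime_of_one_notMem hI h1
    refine ⟨p, hp, fun s hs => ?_⟩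
    obtain ⟨e, he, hse⟩ := hdiv _ ⟨s, hs, rfl⟩
    have hse : (theta ω)⁻¹ * f s = e * p := hse
    refine ⟨e, he, ?_⟩
    field_simp at hse
    linear_combination hse

/-- Adding a multiple of an isotropic vector to make a vector isotropic. -/
theorem exists_isotropic_add_smul {B : V →ₗ[K] V →ₛₗ[σ] K} (hB : IsNondegHermitian B)
    (hσ : IsEisensteinConj ω σ) {n z : V} {k : ℤ} (hnz : B n z = theta ω) (hz : B z z = 0)
    (hn : B n n = 3 * k) : ∃ s ∈ Eis ω, B (n + s • z) (n + s • z) = 0 := by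
  refine ⟨-k * ω, mul_mem (neg_mem (intCast_mem _ _)) omega_mem, ?_⟩
  have hzn : B z n = -theta ω := by rw [← hB.conj, hnz, hσ.map_theta]
  simp only [map_add, map_smul, map_smulₛₗ, LinearMap.add_apply, LinearMap.smul_apply, hnz, hz, hn,
    hzn, smul_eq_mul, map_mul, map_neg, map_intCast, hσ.map_omega, hσ.theta_eq, hσ.sq_omega]
  linear_combination 4 * k * hσ.sq_omega

namespace IsThetaModular

variable {B : V →ₗ[K] V →ₛₗ[σ] K} {L M : Submodule (Eis ω) V}

theorem exists_apply_root_eq_theta (hL : IsThetaModular B L) (hB : IsNondegHermitian B)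
    (hσ : IsEisensteinConj ω σ) {v : V} (hv : v ∈ L) (hvv : B v v = -3) :
    ∃ l ∈ L, B l v = theta ω := by
  rcases exists_eq_theta_or_exists_prime hσ (S := L) (B.flip v)
    (fun s hs => hL.apply_mem hs hv) with h | ⟨p, hp, hdiv⟩
  · exact h
  exfalso
  have hp0 : (p : K) ≠ 0 := by simpa using hp.ne_zero
  have hσp0 : σ p ≠ 0 := by simpa using hp0
  have hk : (σ p)⁻¹ • v ∈ L := by
    refine (hL.mem_iff _).2 fun l hl => ?_
    obtain ⟨e, he, hle⟩ := hdiv l hl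
    rw [LinearMap.flip_apply] at hle
    rw [apply_mem_iff hB hσ, map_smulₛₗ, map_inv₀, hσ.map_map, hle, smul_eq_mul,
      show (p : K)⁻¹ * (e * (p * theta ω)) = e * theta ω by field_simp]
    exact mul_theta_mem he
  obtain ⟨t, ht⟩ := hL.exists_norm_eq hB hσ hk
  simp only [map_smul, map_smulₛₗ, LinearMap.smul_apply, hvv, smul_eq_mul, map_inv₀,
    hσ.map_map] at ht
  refine not_prime_of_mul_eq_one hp (e := -t * σ p)
    (mul_mem (neg_mem (intCast_mem _ _)) (hσ.map_mem p.2)) ?_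
  field_simp at ht
  linear_combination ht

/-- A primitive isotropic vector orthogonal to a root is half of a hyperbolic pair orthogonal to
that root. -/
theorem exists_partner (hL : IsThetaModular B L) (hB : IsNondegHermitian B)
    (hσ : IsEisensteinConj ω σ) {v z : V} (hv : v ∈ L) (hvv : B v v = -3) (hz : z ∈ L)
    (hzz : B z z = 0) (hzv : B z v = 0) (hprim : ∀ c : K, c • z ∈ L → c ∈ Eis ω) :
    ∃ w ∈ L, B w z = theta ω ∧ B w w = 0 ∧ B w v = 0 := by
  have hvz := hB.eq_zero_symm hzv
  rcases exists_eq_theta_or_exists_prime hσ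
    (S := L ⊓ (LinearMap.ker (B.flip v)).restrictScalars (Eis ω)) (B.flip z)
    (fun s hs => hL.apply_mem hs.1 hz) with ⟨n, ⟨hn, hnv⟩, hnz⟩ | ⟨p, hp, hdiv⟩
  · have hnv : B n v = 0 := hnv
    have hnz : B n z = theta ω := hnz
    obtain ⟨k, hk⟩ := hL.exists_norm_eq hB hσ hn
    obtain ⟨s, hs, hss⟩ := exists_isotropic_add_smul hB hσ hnz hzz hk
    exact ⟨n + s • z, add_mem hn (smul_mem_of_mem_eis L hs hz), by simp [hnz, hzz], hss,
      by simp [hnv, hzv]⟩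
  exfalso
  have hp0 : (p : K) ≠ 0 := by simpa using hp.ne_zero
  have hσp0 : σ p ≠ 0 := by simpa using hp0
  have hθ := hσ.theta_ne_zero
  obtain ⟨l₀, hl₀, hl₀v⟩ := hL.exists_apply_root_eq_theta hB hσ hv hvv
  obtain ⟨c, hc, hl₀z⟩ := mem_thetaIdeal.1 (hL.apply_mem hl₀ hz)
  have hk : (σ p)⁻¹ • (z - σ c • v) ∈ L := by
    refine (hL.mem_iff _).2 fun l hl => ?_
    obtain ⟨e, he, hle⟩ := mem_thetaIdeal.1 (hL.apply_mem hl hv)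
    obtain ⟨e', he', hle'⟩ := hdiv (l - e • l₀)
      ⟨sub_mem hl (smul_mem_of_mem_eis L he hl₀), by simp [hle, hl₀v]⟩
    simp only [map_sub, map_smul, LinearMap.flip_apply, hl₀z, smul_eq_mul] at hle'
    rw [apply_mem_iff hB hσ]
    simp only [map_sub, map_smulₛₗ, map_inv₀, hσ.map_map, hle, smul_eq_mul]
    rw [show (p : K)⁻¹ * (B l z - c * (e * theta ω)) = e' * theta ω by
      field_simp; linear_combination hle']
    exact mul_theta_mem he'
  obtain ⟨t, ht⟩ := hL.exists_norm_eq hB hσ hk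
  obtain ⟨e, he, hke⟩ := mem_thetaIdeal.1 (hL.apply_mem hv hk)
  simp only [map_sub, map_smulₛₗ, LinearMap.sub_apply, LinearMap.smul_apply, map_inv₀,
    hσ.map_map, smul_eq_mul, RingHom.id_apply, hzz, hzv, hvz, hvv] at ht hke
  have hnorm : c * σ c = -t * σ p * p := by
    field_simp at ht
    linear_combination -ht / 3
  have hdvd : p ∣ (⟨theta ω, theta_mem⟩ : Eis ω) * ⟨c, hc⟩ := by
    refine ⟨⟨-e, neg_mem he⟩, Subtype.ext ?_⟩
    change theta ω * c = p * -e
    field_simp at hke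
    apply mul_left_cancel₀ hθ
    linear_combination -hke + c * hσ.theta_mul_self
  have hdvd' : p ∣ (⟨c, hc⟩ : Eis ω) := by
    rcases hp.dvd_or_dvd hdvd with ⟨t', ht'⟩ | h
    · have ht' : theta ω = p * t' := congrArg Subtype.val ht'
      rcases hσ.mem_thetaIdeal_of_mul_mem p.2 t'.2 (ht' ▸ theta_mem_thetaIdeal) with h1 | h1
      · have hcc : c * σ c ∈ thetaIdeal ω := by
          rw [hnorm]
          exact mul_mem_thetaIdeal
            (mul_mem (neg_mem (intCast_mem _ _)) (hσ.map_mem p.2)) h1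
        have hcθ : c ∈ thetaIdeal ω := by
          rcases hσ.mem_thetaIdeal_of_mul_mem hc (hσ.map_mem hc) hcc with h2 | h2
          · exact h2
          · exact hσ.map_mem_thetaIdeal_iff.1 h2
        obtain ⟨e₂, he₂, rfl⟩ := mem_thetaIdeal.1 hcθ
        refine ⟨⟨e₂, he₂⟩ * t', Subtype.ext ?_⟩
        change e₂ * theta ω = p * (e₂ * t')
        linear_combination e₂ * ht'
      · obtain ⟨e₂, he₂, h2⟩ := mem_thetaIdeal.1 h1
        exfalso
        refine not_prime_of_mul_eq_one hp he₂ (mul_left_cancel₀ hθ ?_)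
        linear_combination -ht' - p * h2
    · exact h
  obtain ⟨e₂, he₂⟩ := hdvd'
  have he₂ : c = p * e₂ := congrArg Subtype.val he₂
  have hinv : (σ p)⁻¹ ∈ Eis ω := by
    apply hprim
    have := add_mem hk (smul_mem_of_mem_eis L (hσ.map_mem e₂.2) hv)
    rwa [smul_sub, smul_smul, he₂, map_mul, inv_mul_cancel_left₀ hσp0, sub_add_cancel] at this
  have := hσ.map_mem hinv
  rw [map_inv₀, hσ.map_map] at this
  exact not_prime_of_mul_eq_one hp this (inv_mul_cancel₀ hp0)

/-- Every line contains a primitive vector of a modular lattice. -/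
theorem exists_primitive_smul (hL : IsThetaModular B L) (hB : IsNondegHermitian B)
    (hσ : IsEisensteinConj ω σ) {z : V} (hz : z ≠ 0) :
    ∃ c : K, c ≠ 0 ∧ c • z ∈ L ∧ ∀ t : K, t • c • z ∈ L → t ∈ Eis ω := by
  have := hσ.isPrincipalIdealRing
  obtain ⟨l, hl, hzl⟩ : ∃ l ∈ L, B z l ≠ 0 := by
    by_contra! hcon
    refine hz (hB.eq_zero z fun y => ?_)
    obtain ⟨d, -, hd0, hdy⟩ := hL.full y
    simpa [hd0] using hcon _ hdy
  have hθ := hσ.theta_ne_zero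
  let J : Ideal (Eis ω) :=
    { carrier := {a | ∃ c : K, c • z ∈ L ∧ c * B z l = a * theta ω}
      add_mem' := by
        rintro a b ⟨c, hc, hca⟩ ⟨d, hd, hdb⟩
        exact ⟨c + d, by rw [add_smul]; exact add_mem hc hd, by
          push_cast; linear_combination hca + hdb⟩
      zero_mem' := ⟨0, by simp, by simp⟩
      smul_mem' := by
        rintro a b ⟨c, hc, hcb⟩
        refine ⟨a * c, ?_, ?_⟩
        · rw [mul_smul]; exact smul_mem_of_mem_eis L a.2 hc
        · rw [smul_eq_mul]; push_cast; linear_combination (a : K) * hcb }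
  have hJ {c : K} (hc : c • z ∈ L) : ∃ a ∈ J, c * B z l = a * theta ω := by
    obtain ⟨e, he, hce⟩ := mem_thetaIdeal.1 (hL.apply_mem hc hl)
    rw [map_smul, LinearMap.smul_apply, smul_eq_mul] at hce
    exact ⟨⟨e, he⟩, ⟨c, hc, hce⟩, hce⟩
  obtain ⟨c, hc, hca⟩ := Submodule.IsPrincipal.generator_mem J
  have hc0 : c ≠ 0 := by
    rintro rfl
    have hgen : Submodule.IsPrincipal.generator J = 0 := by
      simpa [hθ] using hca
    rw [← Submodule.IsPrincipal.eq_bot_iff_generator_eq_zero] at hgen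
    obtain ⟨d, -, hd0, hdz⟩ := hL.full z
    obtain ⟨a, ha, hda⟩ := hJ hdz
    rw [hgen, Submodule.mem_bot] at ha
    rw [ha, ZeroMemClass.coe_zero, zero_mul] at hda
    exact mul_ne_zero hd0 hzl hda
  refine ⟨c, hc0, hc, fun t ht => ?_⟩
  rw [smul_smul] at ht
  obtain ⟨a, ha, hta⟩ := hJ ht
  obtain ⟨e, rfl⟩ := (Submodule.IsPrincipal.mem_iff_eq_smul_generator J).1 ha
  rw [smul_eq_mul, MulMemClass.coe_mul, mul_assoc t, mul_assoc (e : K), ← hca] at hta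
  exact mul_right_cancel₀ (mul_ne_zero hc0 hzl) hta ▸ e.2

theorem exists_prime_smul_mem (hL : IsThetaModular B L) (hσ : IsEisensteinConj ω σ) {x : V}
    (hx : x ∉ L) : ∃ e : Eis ω, ∃ p : Eis ω, Prime p ∧ (e : K) • x ∉ L ∧
      (p : K) • (e : K) • x ∈ L := by
  have := hσ.isPrincipalIdealRing
  obtain ⟨d, hd, hd0, hdx⟩ := hL.full x
  suffices ∀ d : Eis ω, d ≠ 0 → (d : K) • x ∈ L → ∃ e : Eis ω, ∃ p : Eis ω, Prime p ∧
      (e : K) • x ∉ L ∧ (p : K) • (e : K) • x ∈ L from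
    this ⟨d, hd⟩ (by simpa [Subtype.ext_iff] using hd0) hdx
  clear! d
  intro d
  induction d using UniqueFactorizationMonoid.induction_on_prime with
  | h₁ => exact fun h => absurd rfl h
  | h₂ u hu =>
    intro _ hux
    obtain ⟨u, rfl⟩ := hu
    refine absurd ?_ hx
    have h1 : ((u⁻¹ : (Eis ω)ˣ) : Eis ω) • (u : Eis ω) • x ∈ L := L.smul_mem _ hux
    rwa [smul_smul, u.inv_mul, one_smul] at h1
  | h₃ a p ha hp ih =>
    intro _ hax
    by_cases h : (a : K) • x ∈ L
    · exact ih ha h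
    · exact ⟨a, p, hp, h, by rwa [smul_smul]⟩

end IsThetaModular

/-- A hyperbolic pair orthogonal to the vector `v`. -/
structure IsHyperbolicPair (B : V →ₗ[K] V →ₛₗ[σ] K) (ω : K) (v z w : V) : Prop where
  left_left : B z z = 0
  right_right : B w w = 0
  right_left : B w z = theta ω
  left_root : B z v = 0
  right_root : B w v = 0

theorem IsHyperbolicPair.left_right {B : V →ₗ[K] V →ₛₗ[σ] K} {v z w : V}
    (h : IsHyperbolicPair B ω v z w) (hB : IsNondegHermitian B) (hσ : IsEisensteinConj ω σ) :
    B z w = -theta ω := by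
  rw [← hB.conj, h.right_left, hσ.map_theta]

variable [FiniteDimensional K V] {B : V →ₗ[K] V →ₛₗ[σ] K} {L M : Submodule (Eis ω) V}
  {v z w : V}

namespace IsThetaModular

/-- A modular lattice can be moved by an isometry fixing the root `v` so that it contains a given
hyperbolic pair orthogonal to `v`. -/
theorem exists_latticeEquiv_pair_mem (hM : IsThetaModular B M) (hB : IsNondegHermitian B)
    (hσ : IsEisensteinConj ω σ) (hv : v ∈ M) (hvv : B v v = -3)
    (hzw : IsHyperbolicPair B ω v z w) :
    ∃ N, IsThetaModular B N ∧ LatticeEquiv B v M N ∧ z ∈ N ∧ w ∈ N := by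
  have hθ := hσ.theta_ne_zero
  have hw0 : w ≠ 0 := by
    rintro rfl
    exact hθ (by simpa using hzw.right_left.symm)
  obtain ⟨c, hc0, hc, hprim⟩ := hM.exists_primitive_smul hB hσ hw0
  obtain ⟨x, hx, hxw, hxx, hxv⟩ := hM.exists_partner hB hσ hv hvv hc
    (by simp [hzw.right_right]) (by simp [hzw.right_root]) hprim
  obtain ⟨g, hg, hgw, hgfix⟩ := hB.exists_reflection (a := c • w) (b := z)
    (by simp [hzw.right_right, hzw.left_left])
    (by simp [hzw.right_right, hzw.right_left, hc0, hθ])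
  have hgv : g v = v := hgfix v (by
    simp [hB.eq_zero_symm hzw.left_root, hB.eq_zero_symm hzw.right_root])
  obtain ⟨y, hy, hyy, hyz, hyv, hyw⟩ : ∃ y ∈ mapLattice g M, B y y = 0 ∧ B y z = theta ω ∧
      B y v = 0 ∧ B y w ≠ 0 := by
    have h1 : g x ∈ mapLattice g M := apply_mem_mapLattice.2 hx
    have h2 : z ∈ mapLattice g M := hgw ▸ apply_mem_mapLattice.2 hc
    have h3 : B (g x) z = theta ω := by rw [← hgw, hg, hxw]
    have h4 : B (g x) v = 0 := by rw [← hgv, hg, hxv]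
    have h5 : B (g x) (g x) = 0 := by rw [hg, hxx]
    have h6 : B z (g x) = -theta ω := by rw [← hB.conj, h3, hσ.map_theta]
    by_cases h0 : B (g x) w = 0
    · exact ⟨g x + z, add_mem h1 h2, by simp [h3, h5, h6, hzw.left_left],
        by simp [h3, hzw.left_left], by simp [h4, hzw.left_root],
        by simp [h0, hzw.left_right hB hσ, hθ]⟩
    · exact ⟨g x, h1, h5, h3, h4, h0⟩
  have hzy : B z y = -theta ω := by rw [← hB.conj, hyz, hσ.map_theta]
  obtain ⟨f, hf, hfy, hffix⟩ := hB.exists_reflection (a := y) (b := w)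
    (by rw [hyy, hzw.right_right]) (by simp [hyy, hyw])
  have hfv : f v = v := hffix v (by
    simp [hB.eq_zero_symm hyv, hB.eq_zero_symm hzw.right_root])
  have hfz : f z = z := hffix z (by simp [hzy, hzw.left_right hB hσ])
  refine ⟨mapLattice f (mapLattice g M), (hM.map hg).map hf,
    (latticeEquiv_mapLattice M hg hgv).trans (latticeEquiv_mapLattice _ hf hfv), ?_, ?_⟩
  · rw [← hfz, apply_mem_mapLattice, ← hgw]
    exact apply_mem_mapLattice.2 hc
  · rwa [← hfy, apply_mem_mapLattice]

/-- An isometry rescaling a hyperbolic pair. -/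
theorem exists_rescaling (hB : IsNondegHermitian B) (hσ : IsEisensteinConj ω σ) {a b : V} {p : K}
    (hp : p ≠ 0) (ha : B a a = 0) (hb : B b b = 0) (hba : B b a = theta ω) :
    ∃ g : V ≃ₗ[K] V, (∀ x y, B (g x) (g y) = B x y) ∧
      ∀ x, g x = x - ((p⁻¹ - 1) * (B x b / theta ω)) • a + ((σ p - 1) * (B x a / theta ω)) • b := by
  have hθ := hσ.theta_ne_zero
  have hσp : σ p ≠ 0 := by simpa using hp
  have hab : B a b = -theta ω := by rw [← hB.conj, hba, hσ.map_theta]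
  let f : V →ₗ[K] V := LinearMap.id - (((p⁻¹ - 1) * (theta ω)⁻¹) • B.flip b).smulRight a +
    (((σ p - 1) * (theta ω)⁻¹) • B.flip a).smulRight b
  have hfx (x : V) : f x = x - ((p⁻¹ - 1) * (B x b / theta ω)) • a +
      ((σ p - 1) * (B x a / theta ω)) • b := by
    simp [f, div_eq_mul_inv, mul_assoc, mul_comm, mul_left_comm]
  have hf (x y : V) : B (f x) (f y) = B x y := by
    rw [hfx, hfx]
    simp only [map_sub, map_add, map_smul, LinearMap.sub_apply, LinearMap.add_apply,
      LinearMap.smul_apply, map_smulₛₗ, map_mul, map_inv₀, map_div₀, hB.conj, smul_eq_mul, ha, hb,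
      hab, hba, hσ.map_theta, hσ.map_map, map_one]
    field_simp
    ring
  obtain ⟨g, hg⟩ := hB.exists_equiv f hf
  exact ⟨g, fun x y => by rw [hg, hg, hf], fun x => by rw [hg, hfx]⟩

/-- The neighbour of a modular lattice at a vector `x` orthogonal to a root and a hyperbolic pair
is equivalent to the lattice. -/
theorem exists_neighbor (hM : IsThetaModular B M) (hB : IsNondegHermitian B)
    (hσ : IsEisensteinConj ω σ) (hv : v ∈ M) (hvv : B v v = -3)
    (hzw : IsHyperbolicPair B ω v z w) (hz : z ∈ M) (hw : w ∈ M) {x : V} {p : Eis ω}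
    (hp : Prime p) (hpx : (p : K) • x ∈ M) (hx : x ∉ M) (hxx : B x x ∈ thetaIdeal ω)
    (hxz : B x z = 0) (hxw : B x w = 0) (hxv : B x v = 0) :
    ∃ N, IsThetaModular B N ∧ LatticeEquiv B v M N ∧ x ∈ N ∧
      ∀ m ∈ M, B m x ∈ thetaIdeal ω → m ∈ N := by
  have hθ := hσ.theta_ne_zero
  have hp0 : (p : K) ≠ 0 := by simpa using hp.ne_zero
  have hσp0 : σ p ≠ 0 := by simpa using hp0
  obtain ⟨k, hk⟩ := hσ.eq_three_mul_of_map_eq hxx (hB.conj x x)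
  obtain ⟨s, hs, hy⟩ := exists_isotropic_add_smul hB hσ (n := x + w) (z := z) (k := k)
    (by simp [hxz, hzw.right_left]) hzw.left_left
    (by simp [hk, hxw, hB.eq_zero_symm hxw, hzw.right_right])
  have hu : w + s • z ∈ M := add_mem hw (smul_mem_of_mem_eis M hs hz)
  set y := x + w + s • z with hydef
  have hyeq : y = x + (w + s • z) := by rw [hydef, add_assoc]
  have hyz : B y z = theta ω := by simp [hydef, hxz, hzw.right_left, hzw.left_left]
  have hyv : B y v = 0 := by simp [hydef, hxv, hzw.right_root, hzw.left_root]
  have hpy : (p : K) • y ∈ M := by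
    rw [hyeq, smul_add]
    exact add_mem hpx (smul_mem_of_mem_eis M p.2 hu)
  have hprim (c : K) (hc : c • (p : K) • y ∈ M) : c ∈ Eis ω := by
    obtain ⟨e, he, hce⟩ := mem_thetaIdeal.1 (hM.apply_mem hc hz)
    simp only [map_smul, LinearMap.smul_apply, hyz, smul_eq_mul] at hce
    have hce : c * p = e := mul_right_cancel₀ hθ (by linear_combination hce)
    have hex : e • x ∈ M := by
      rw [smul_smul, hce, hyeq, smul_add] at hc
      simpa using sub_mem hc (smul_mem_of_mem_eis M he hu)
    have := hσ.isPrincipalIdealRing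
    have hdvd : p ∣ (⟨e, he⟩ : Eis ω) := by
      by_contra hndvd
      obtain ⟨a, b, hab⟩ := (hp.irreducible.coprime_iff_not_dvd).2 hndvd
      have hab : (a : K) * p + b * e = 1 := congrArg Subtype.val hab
      apply hx
      have := add_mem (smul_mem_of_mem_eis M a.2 hpx) (smul_mem_of_mem_eis M b.2 hex)
      rwa [smul_smul, smul_smul, ← add_smul, hab, one_smul] at this
    obtain ⟨d, hd⟩ := hdvd
    have hd : e = p * d := congrArg Subtype.val hd
    have : c = d := mul_right_cancel₀ hp0 (by rw [hce, hd, mul_comm])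
    exact this ▸ d.2
  obtain ⟨b, hb, hby, hbb, hbv⟩ := hM.exists_partner hB hσ hv hvv hpy (by simp [hy])
    (by simp [hyv]) hprim
  obtain ⟨g, hg, hgx⟩ := exists_rescaling hB hσ hp0 (a := (p : K) • y) (b := b) (by simp [hy])
    hbb hby
  have hgv : g v = v := by
    rw [hgx]; simp [hB.eq_zero_symm hyv, hB.eq_zero_symm hbv]
  have hN := hM.map hg
  /- A vector of `g M` is a combination of `y`, `σ p • b` and a vector of `M` orthogonal to `y`. -/
  have hform (l : V) (hl : l ∈ M) : ∃ c ∈ Eis ω, ∃ d ∈ Eis ω, ∃ m ∈ M, B m y = 0 ∧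
      g l = c • y + (d * σ p) • b + m := by
    obtain ⟨c, hc, hlc⟩ := mem_thetaIdeal.1 (hM.apply_mem hl hb)
    obtain ⟨d, hd, hld⟩ := mem_thetaIdeal.1 (hM.apply_mem hl hpy)
    refine ⟨-c, neg_mem hc, d, hd, l + c • (p : K) • y - d • b,
      sub_mem (add_mem hl (smul_mem_of_mem_eis M hc hpy)) (smul_mem_of_mem_eis M hd hb), ?_, ?_⟩
    · have h0 : B (l + c • (p : K) • y - d • b) ((p : K) • y) = 0 := by
        rw [map_sub, map_add, LinearMap.sub_apply, LinearMap.add_apply, hld, map_smul B d,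
          LinearMap.smul_apply, hby]
        simp [hy]
      simpa [hσp0] using h0
    · rw [hgx, hlc, hld, mul_div_cancel_right₀ _ hθ, mul_div_cancel_right₀ _ hθ]
      match_scalars
      all_goals field_simp
      all_goals ring
  refine ⟨mapLattice g M, hN, latticeEquiv_mapLattice M hg hgv, ?_, fun m hm hmx => ?_⟩
  · refine (hN.mem_iff x).2 fun l hl => ?_
    obtain ⟨l, rfl⟩ := g.surjective l
    obtain ⟨c, hc, d, hd, m, hm, hmy, hgl⟩ := hform l (apply_mem_mapLattice.1 hl)
    have h1 : B x y = B x x := by simp [hydef, hxw, hxz]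
    have h2 : B x m = -B (w + s • z) m := by
      have h0 : B y m = 0 := hB.eq_zero_symm hmy
      rw [hyeq, map_add, LinearMap.add_apply] at h0
      linear_combination h0
    have h3 : B x ((d * σ p) • b) = σ d * B ((p : K) • x) b := by
      simp [hσ.map_map]; ring
    rw [hgl, map_add, map_add, h2, h3, map_smulₛₗ, h1, smul_eq_mul]
    exact add_mem (add_mem (mul_mem_thetaIdeal (hσ.map_mem hc) hxx)
      (mul_mem_thetaIdeal (hσ.map_mem hd) (hM.apply_mem hpx hb)))
      (neg_mem (hM.apply_mem hu hm))
  · refine (hN.mem_iff m).2 fun l hl => ?_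
    obtain ⟨l, rfl⟩ := g.surjective l
    obtain ⟨c, hc, d, hd, m', hm', -, hgl⟩ := hform l (apply_mem_mapLattice.1 hl)
    rw [hgl, map_add, map_add, map_smulₛₗ, map_smulₛₗ, hyeq, map_add]
    exact add_mem (add_mem
      (mul_mem_thetaIdeal (hσ.map_mem hc) (add_mem hmx (hM.apply_mem hm hu)))
      (mul_mem_thetaIdeal (hσ.map_mem (mul_mem hd (hσ.map_mem p.2))) (hM.apply_mem hm hb)))
      (hM.apply_mem hm hm')

theorem latticeEquiv_of_orthogonal_le (hL : IsThetaModular B L) (hM : IsThetaModular B M)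
    (hB : IsNondegHermitian B) (hσ : IsEisensteinConj ω σ) (hvL : v ∈ L) (hvM : v ∈ M)
    (hvv : B v v = -3) (hle : ∀ x ∈ L, B x v = 0 → x ∈ M) : LatticeEquiv B v M L := by
  have hθ := hσ.theta_mul_self
  have hσθ := hσ.map_theta
  obtain ⟨a, ha, hav⟩ := hM.exists_apply_root_eq_theta hB hσ hvM hvv
  obtain ⟨b, hb, hbv⟩ := hL.exists_apply_root_eq_theta hB hσ hvL hvv
  /- The projection of a vector of minimal pairing to the orthogonal complement of the root. -/
  have hproj {l : V} {k : ℤ} (hlv : B l v = theta ω) (hll : B l l = 3 * k) :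
      B (l + (theta ω / 3) • v) v = 0 ∧
        B (l + (theta ω / 3) • v) (l + (theta ω / 3) • v) = 3 * k + 1 := by
    have hvl : B v l = -theta ω := by rw [← hB.conj, hlv, hσθ]
    constructor <;>
    simp only [map_add, map_smul, map_smulₛₗ, LinearMap.add_apply, LinearMap.smul_apply, hlv, hvl,
      hvv, hll, smul_eq_mul, map_div₀, hσθ, map_ofNat]
    · ring
    · linear_combination (-1 / 3) * hθ
  obtain ⟨k, hk⟩ := hM.exists_norm_eq hB hσ ha
  obtain ⟨k', hk'⟩ := hL.exists_norm_eq hB hσ hb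
  obtain ⟨hnv, hnn⟩ := hproj hav hk
  obtain ⟨hnv', hnn'⟩ := hproj hbv hk'
  set n := a + (theta ω / 3) • v with hn
  set n' := b + (theta ω / 3) • v with hn'
  have hθn' : theta ω • n' ∈ L := by
    rw [hn', smul_add, smul_smul, ← mul_div_assoc, hθ]
    exact add_mem (smul_mem_of_mem_eis L theta_mem hb)
      (by simpa using neg_mem hvL)
  have hpair {x : V} (hx : B x v = 0) : B x n = B x a ∧ B x n' = B x b := by
    simp [hn, hn', hx]
  have hc : B n n' ∈ Eis ω := by
    obtain ⟨e, he, hae⟩ := mem_thetaIdeal.1 (hM.apply_mem (hle _ hθn' (by simp [hnv'])) ha)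
    have : B n' n = e := mul_right_cancel₀ hσ.theta_ne_zero (by
      rw [(hpair hnv').1, ← hae]; simp [mul_comm])
    rw [← hB.conj, this]
    exact hσ.map_mem he
  set c := B n n' with hcdef
  have hδv : B (n - c • n') v = 0 := by simp [hnv, hnv']
  have hδL : n - c • n' ∈ L := by
    refine (hL.mem_iff _).2 fun l hl => ?_
    obtain ⟨e, he, hle'⟩ := mem_thetaIdeal.1 (hL.apply_mem hl hvL)
    have hm : l - e • b ∈ L := sub_mem hl (smul_mem_of_mem_eis L he hb)
    have hmv : B (l - e • b) v = 0 := by simp [hle', hbv]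
    have h1 : B (n - c • n') b = -(k' * c) * 3 := by
      rw [← (hpair hδv).2, map_sub, LinearMap.sub_apply, map_smul, LinearMap.smul_apply, hnn',
        ← hcdef, smul_eq_mul]
      ring
    have h2 : B (n - c • n') (l - e • b) = B a (l - e • b) - c * B b (l - e • b) := by
      have hvm := hB.eq_zero_symm hmv
      rw [hn, hn']
      simp only [map_sub, map_add, map_smul, LinearMap.sub_apply, LinearMap.add_apply,
        LinearMap.smul_apply, smul_eq_mul] at hvm ⊢
      linear_combination (theta ω / 3 - c * (theta ω / 3)) * hvm
    rw [← sub_add_cancel l (e • b), map_add, h2, map_smulₛₗ, h1]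
    exact add_mem (sub_mem (hM.apply_mem ha (hle _ hm hmv))
      (mul_mem_thetaIdeal hc (hL.apply_mem hb hm)))
      (mul_mem_thetaIdeal (hσ.map_mem he) (mul_mem_thetaIdeal
        (neg_mem (mul_mem (intCast_mem _ _) hc)) hσ.three_mem_thetaIdeal))
  have hcθ : c ∉ thetaIdeal ω := by
    intro hcθ
    have h1 := hM.apply_mem (hle _ hδL hδv) ha
    rw [← (hpair hδv).1, apply_mem_iff hB hσ, map_sub, map_smulₛₗ, hnn, ← hcdef, smul_eq_mul] at h1
    have h2 := sub_mem (add_mem h1 (mul_mem_thetaIdeal (hσ.map_mem hc) hcθ))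
      (mul_mem_thetaIdeal (intCast_mem (Eis ω) k) hσ.three_mem_thetaIdeal)
    exact hσ.one_notMem_thetaIdeal (by convert h2 using 1; ring)
  rcases (hσ.exists_residue hc).resolve_left hcθ with h1 | h1
  · obtain ⟨e, he, hce⟩ := mem_thetaIdeal.1 h1
    have haL : a ∈ L := by
      have : a = b + ((n - c • n') + e • theta ω • n') := by
        rw [smul_smul, ← hce, hn, hn']; module
      rw [this]
      exact add_mem hb (add_mem hδL (smul_mem_of_mem_eis L he hθn'))
    rw [hL.eq_of_orthogonal_le hM hvL hle haL ha hav]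
    exact LatticeEquiv.refl B v M
  · obtain ⟨e, he, hce⟩ := mem_thetaIdeal.1 h1
    obtain ⟨g, hg, hgv, hgneg⟩ := hB.exists_isometry (a := v) (b := v) rfl (by
      rw [map_add, hvv]; norm_num)
    have hgneg' (x : V) (hx : B x v = 0) : g x = -x := hgneg x (by simp [hx])
    have hga : g a = b - ((n - c • n') + e • theta ω • n') := by
      have : a = n - (theta ω / 3) • v := by rw [hn, add_sub_cancel_right]
      rw [this, map_sub, map_smul, hgv, hgneg' n hnv, smul_smul, ← hce, hn']
      module
    have hgaL : g a ∈ L := by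
      rw [hga]
      exact sub_mem hb (add_mem hδL (smul_mem_of_mem_eis L he hθn'))
    have hgM : L = mapLattice g M :=
      hL.eq_of_orthogonal_le (hM.map hg) hvL (fun x hx hxv => by
        have hx' : x = g (-x) := by rw [map_neg, hgneg' x hxv, neg_neg]
        rw [hx', apply_mem_mapLattice]
        exact neg_mem (hle x hx hxv)) hgaL (apply_mem_mapLattice.2 ha)
        (by rw [← hav, ← hg a v, hgv])
    rw [hgM]
    exact latticeEquiv_mapLattice M hg hgv

theorem latticeEquiv_of_pair_mem (hL : IsThetaModular B L) (hfg : L.FG)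
    (hB : IsNondegHermitian B) (hσ : IsEisensteinConj ω σ) (hvv : B v v = -3)
    (hzw : IsHyperbolicPair B ω v z w) (hvL : v ∈ L) (hzL : z ∈ L) (hwL : w ∈ L)
    (hM : IsThetaModular B M) (hvM : v ∈ M) (hzM : z ∈ M) (hwM : w ∈ M) :
    LatticeEquiv B v M L := by
  have := hσ.isPrincipalIdealRing
  have : IsNoetherian (Eis ω) L := isNoetherian_of_fg_of_noetherian L hfg
  induction hI : M.comap L.subtype using WellFoundedGT.induction generalizing M with
  | ind I ih =>
  subst hI
  by_cases hle : ∀ x ∈ L, B x v = 0 → B x z = 0 → B x w = 0 → x ∈ M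
  · refine hL.latticeEquiv_of_orthogonal_le hM hB hσ hvL hvM hvv fun x hx hxv => ?_
    obtain ⟨c, hc, hxz⟩ := mem_thetaIdeal.1 (hL.apply_mem hx hzL)
    obtain ⟨d, hd, hxw⟩ := mem_thetaIdeal.1 (hL.apply_mem hx hwL)
    have h1 := hle (x - c • w + d • z)
      (add_mem (sub_mem hx (smul_mem_of_mem_eis L hc hwL)) (smul_mem_of_mem_eis L hd hzL))
      (by simp [hxv, hzw.left_root, hzw.right_root])
      (by simp [hxz, hzw.left_left, hzw.right_left])
      (by simp [hxw, hzw.right_right, hzw.left_right hB hσ])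
    have h2 := add_mem (sub_mem h1 (smul_mem_of_mem_eis M hd hzM))
      (smul_mem_of_mem_eis M hc hwM)
    rwa [add_sub_cancel_right, sub_add_cancel] at h2
  · push Not at hle
    obtain ⟨x₀, hx₀L, hx₀v, hx₀z, hx₀w, hx₀M⟩ := hle
    obtain ⟨e, p, hp, hxM, hpx⟩ := hM.exists_prime_smul_mem hσ hx₀M
    have hxL : (e : K) • x₀ ∈ L := smul_mem_of_mem_eis L e.2 hx₀L
    have hxv : B ((e : K) • x₀) v = 0 := by simp [hx₀v]
    have hxz : B ((e : K) • x₀) z = 0 := by simp [hx₀z]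
    have hxw : B ((e : K) • x₀) w = 0 := by simp [hx₀w]
    obtain ⟨N, hN, hMN, hxN, hle'⟩ := hM.exists_neighbor hB hσ hvM hvv hzw hzM hwM hp hpx hxM
      (hL.apply_mem hxL hxL) hxz hxw hxv
    have hmem {y : V} (hy : y ∈ M) (hxy : B ((e : K) • x₀) y = 0) : y ∈ N :=
      hle' y hy (by rw [hB.eq_zero_symm hxy]; exact zero_mem _)
    refine hMN.trans (ih _ ?_ hN (hmem hvM hxv) (hmem hzM hxz) (hmem hwM hxw) rfl)
    refine lt_of_le_of_ne (fun y hy => hle' y hy (hL.apply_mem y.2 hxL)) fun heq => hxM ?_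
    exact (SetLike.ext_iff.1 heq ⟨(e : K) • x₀, hxL⟩).2 hxN

/-- In a modular lattice containing a hyperbolic pair orthogonal to a root, every root is equivalent
to that one. -/
theorem exists_isometry_root (hL : IsThetaModular B L) (hfg : L.FG)
    (hB : IsNondegHermitian B) (hσ : IsEisensteinConj ω σ) (hvv : B v v = -3)
    (hzw : IsHyperbolicPair B ω v z w) (hvL : v ∈ L) (hzL : z ∈ L) (hwL : w ∈ L) {u : V}
    (huL : u ∈ L) (huu : B u u = -3) :
    ∃ g : V ≃ₗ[K] V, (∀ x y, B (g x) (g y) = B x y) ∧ (∀ x, g x ∈ L ↔ x ∈ L) ∧ g u = v := by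
  obtain ⟨g, hg, hgu⟩ : ∃ g : V ≃ₗ[K] V, (∀ x y, B (g x) (g y) = B x y) ∧ g u = v := by
    by_cases h : B u (u - v) = 0
    · obtain ⟨g, hg, hgu, -⟩ := hB.exists_isometry (a := u) (b := v) (by rw [huu, hvv]) (by
        rw [map_sub, huu] at h
        rw [map_add, huu, ← sub_eq_zero.1 h]
        norm_num)
      exact ⟨g, hg, hgu⟩
    · obtain ⟨g, hg, hgu, -⟩ := hB.exists_reflection (a := u) (b := v) (by rw [huu, hvv]) h
      exact ⟨g, hg, hgu⟩
  have hv : v ∈ mapLattice g L := hgu ▸ apply_mem_mapLattice.2 huL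
  obtain ⟨N, hN, hLN, hzN, hwN⟩ := (hL.map hg).exists_latticeEquiv_pair_mem hB hσ hv hvv hzw
  have hvN : v ∈ N := by
    obtain ⟨f, -, hfv, hf⟩ := hLN
    rw [← hfv, hf]
    exact hv
  obtain ⟨f, hf, hfv, hfL⟩ := hLN.trans
    (hL.latticeEquiv_of_pair_mem hfg hB hσ hvv hzw hvL hzL hwL hN hvN hzN hwN)
  exact ⟨g.trans f, fun x y => by simp [hf, hg], fun x => by simp [hfL], by simp [hgu, hfv]⟩

end IsThetaModular

end Hermitian

/-! ### The lattice spanned by the `Y₅₅₅` vectors -/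

section Y555

variable {K : Type*} [Field K] {ω : K} {σ : K →+* K}

/-- The `j`-th coordinate in the `i`-th block of four coordinates. -/
def blockCoord (i : Fin 3) (j : Fin 4) : Fin 14 := ⟨4 * i + j, by omega⟩

theorem forall_coord {P : Fin 14 → Prop} (h : ∀ i j, P (blockCoord i j)) (h₁₂ : P 12)
    (h₁₃ : P 13) (j : Fin 14) : P j := by
  have hlt := j.2
  by_cases hj : (j : ℕ) < 12
  · convert h ⟨j / 4, by omega⟩ ⟨j % 4, by omega⟩
    exact Fin.ext (Nat.div_add_mod _ _).symm
  · obtain hj | hj : (j : ℕ) = 12 ∨ (j : ℕ) = 13 := by omega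
    · exact Fin.ext (b := 12) hj ▸ h₁₂
    · exact Fin.ext (b := 13) hj ▸ h₁₃

theorem innerV_eq (x y : Fin 14 → K) : innerV ω σ x y =
    -(∑ i, ∑ j, x (blockCoord i j) * σ (y (blockCoord i j))) +
      theta ω * (x 13 * σ (y 12) - x 12 * σ (y 13)) := by
  simp [innerV, Fin.sum_univ_succ, blockCoord, theta]
  ring

/-- The form `innerV` as a sesquilinear map. -/
def innerForm (ω : K) (σ : K →+* K) : (Fin 14 → K) →ₗ[K] (Fin 14 → K) →ₛₗ[σ] K :=
  LinearMap.mk₂'ₛₗ (RingHom.id K) σ (innerV ω σ)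
    (fun x x' y => by
      simp only [innerV_eq, Pi.add_apply, add_mul, Finset.sum_add_distrib]; ring)
    (fun c x y => by
      simp only [innerV_eq, Pi.smul_apply, smul_eq_mul, mul_assoc, ← Finset.mul_sum,
        RingHom.id_apply]
      ring)
    (fun x y y' => by
      simp only [innerV_eq, Pi.add_apply, map_add, mul_add, Finset.sum_add_distrib]; ring)
    (fun c x y => by
      simp only [innerV_eq, Pi.smul_apply, smul_eq_mul, map_mul, mul_left_comm _ (σ c),
        ← Finset.mul_sum]
      ring)

theorem innerForm_apply (x y : Fin 14 → K) : innerForm ω σ x y = innerV ω σ x y := rfl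

theorem innerForm_single_blockCoord (x : Fin 14 → K) (c : K) (i : Fin 3) (j : Fin 4) :
    innerForm ω σ x (Pi.single (blockCoord i j) c) = -(x (blockCoord i j) * σ c) := by
  have hlt : (blockCoord i j : ℕ) < 12 := by simp only [blockCoord]; omega
  have h₁₂ : (12 : Fin 14) ≠ blockCoord i j := (Fin.ne_of_val_ne hlt.ne).symm
  have h₁₃ : (13 : Fin 14) ≠ blockCoord i j :=
    (Fin.ne_of_val_ne (hlt.trans (Nat.lt_succ_self 12)).ne).symm
  rw [innerForm_apply, innerV, Finset.sum_eq_single (blockCoord i j)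
    (fun k _ hk => by simp [hk]) (by simp)]
  simp [h₁₂, h₁₃, hlt]

theorem innerForm_single_twelve (x : Fin 14 → K) (c : K) :
    innerForm ω σ x (Pi.single 12 c) = theta ω * (x 13 * σ c) := by
  rw [innerForm_apply, innerV, Finset.sum_eq_zero fun j _ => ?_]
  · simp [theta]
  · grind

theorem innerForm_single_thirteen (x : Fin 14 → K) (c : K) :
    innerForm ω σ x (Pi.single 13 c) = -theta ω * (x 12 * σ c) := by
  rw [innerForm_apply, innerV, Finset.sum_eq_zero fun j _ => ?_]
  · simp [theta]
  · grind

/-- The lattice spanned by the `Y₅₅₅` vectors, described by congruences modulo `θ`. -/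
def latticeY555 (ω : K) : Submodule (Eis ω) (Fin 14 → K) where
  carrier := {x | (∀ j, x j ∈ Eis ω) ∧ ∀ i,
    x (blockCoord i 1) + x (blockCoord i 2) + x (blockCoord i 3) ∈ thetaIdeal ω ∧
    x (blockCoord i 0) + x (blockCoord i 1) - x (blockCoord i 2) ∈ thetaIdeal ω}
  zero_mem' := by simp
  add_mem' := by
    rintro x y ⟨hx, hx'⟩ ⟨hy, hy'⟩
    refine ⟨fun j => add_mem (hx j) (hy j), fun i => ⟨?_, ?_⟩⟩
    · convert add_mem (hx' i).1 (hy' i).1 using 1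
      simp only [Pi.add_apply]; ring
    · convert add_mem (hx' i).2 (hy' i).2 using 1
      simp only [Pi.add_apply]; ring
  smul_mem' := by
    rintro c x ⟨hx, hx'⟩
    refine ⟨fun j => mul_mem c.2 (hx j), fun i => ⟨?_, ?_⟩⟩
    · convert Submodule.smul_mem _ c (hx' i).1 using 1
      simp only [Pi.smul_apply, smul_add]
    · convert Submodule.smul_mem _ c (hx' i).2 using 1
      simp only [Pi.smul_apply, smul_add, smul_sub]

theorem mem_latticeY555_of_forall_mem_thetaIdeal {x : Fin 14 → K}
    (hx : ∀ j, x j ∈ thetaIdeal ω) : x ∈ latticeY555 ω := by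
  refine ⟨fun j => ?_, fun i => ⟨add_mem (add_mem (hx _) (hx _)) (hx _),
    sub_mem (add_mem (hx _) (hx _)) (hx _)⟩⟩
  obtain ⟨e, he, hxe⟩ := mem_thetaIdeal.1 (hx j)
  exact hxe ▸ mul_mem he theta_mem

theorem single_theta_mem (j : Fin 14) : Pi.single j (theta ω) ∈ latticeY555 ω :=
  mem_latticeY555_of_forall_mem_thetaIdeal fun k => by
    rw [Pi.single_apply]
    split_ifs
    exacts [theta_mem_thetaIdeal, zero_mem _]

theorem single_one_mem {k : Fin 14} (hk : 12 ≤ k) : Pi.single k 1 ∈ latticeY555 ω := by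
  have hne (i : Fin 3) (j : Fin 4) : blockCoord i j ≠ k :=
    Fin.ne_of_val_ne (by simp [blockCoord]; have : 12 ≤ (k : ℕ) := hk; omega)
  refine ⟨fun j => ?_, fun i => by simp [hne]⟩
  rw [Pi.single_apply]
  split_ifs
  exacts [one_mem _, zero_mem _]

theorem isHyperbolicPair_single :
    IsHyperbolicPair (innerForm ω σ) ω (Pi.single (blockCoord 0 0) (theta ω))
      (Pi.single 12 1) (Pi.single 13 1) where
  left_left := by simp [innerForm_single_twelve]
  right_right := by simp [innerForm_single_thirteen]
  right_left := by simp [innerForm_single_twelve]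
  left_root := by rw [innerForm_single_blockCoord]; simp [blockCoord]
  right_root := by rw [innerForm_single_blockCoord]; simp [blockCoord]

variable [CharZero K]

set_option maxHeartbeats 1000000 in
theorem Y555vecs_mem (hσ : IsEisensteinConj ω σ) (k : Fin 16) : Y555vecs ω k ∈ latticeY555 ω := by
  have h1 : ω ^ 2 ∈ Eis ω := pow_mem omega_mem 2
  have h2 : ω - ω ^ 2 ∈ Eis ω := theta_mem
  have h3 : ω ^ 2 - ω ∈ Eis ω := by simpa [theta] using neg_mem (theta_mem (ω := ω))
  have h4 : ω - ω ^ 2 ∈ thetaIdeal ω := theta_mem_thetaIdeal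
  have h5 : ω ^ 2 - ω ∈ thetaIdeal ω := by
    simpa [theta] using neg_mem (theta_mem_thetaIdeal (ω := ω))
  have h6 : (1 : K) + 1 + 1 ∈ thetaIdeal ω := by
    convert hσ.three_mem_thetaIdeal using 1; norm_num
  have h7 : (-1 : K) + -1 - 1 ∈ thetaIdeal ω := by
    convert neg_mem hσ.three_mem_thetaIdeal using 1; norm_num
  fin_cases k <;>
  refine ⟨fun j => ?_, fun i => ?_⟩
  all_goals first | fin_cases j | fin_cases i
  all_goals simp [Y555vecs, blockCoord, h1, h2, h3, h4, h5, h6, h7]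

/-- The index of the `k`-th vector of the `i`-th arm of the `Y₅₅₅` diagram. -/
def armIndex (i : Fin 3) (k : Fin 5) : Fin 16 := ⟨5 * i + k + 1, by omega⟩

theorem latticeY555_eq_span (hσ : IsEisensteinConj ω σ) :
    latticeY555 ω = Submodule.span (Eis ω) (Set.range (Y555vecs ω)) := by
  refine le_antisymm ?_ (Submodule.span_le.2 (Set.range_subset_iff.2 (Y555vecs_mem hσ)))
  rintro x ⟨hx, hx'⟩
  have hmem (k : Fin 16) {e : K} (he : e ∈ Eis ω) :
      e • Y555vecs ω k ∈ Submodule.span (Eis ω) (Set.range (Y555vecs ω)) :=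
    smul_mem_of_mem_eis _ he (Submodule.subset_span (Set.mem_range_self k))
  choose s hs hs' using fun i => mem_thetaIdeal.1 (hx' i).1
  choose t ht ht' using fun i => mem_thetaIdeal.1 (hx' i).2
  let β : Fin 3 → K := Pi.single 0 (x 13 - ω ^ 2 * x 12)
  let γ (i : Fin 3) : K := x (blockCoord i 3) + theta ω * β i
  let δ (i : Fin 3) : K := s i + theta ω * x (blockCoord i 3) - 2 * β i
  let ε (i : Fin 3) : K := x (blockCoord i 2) - γ i
  let φ (i : Fin 3) : K := s i - t i + theta ω * x (blockCoord i 2) + β i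
  have hβ (i : Fin 3) : β i ∈ Eis ω := by
    simp only [β, Pi.single_apply]
    split_ifs
    exacts [sub_mem (hx _) (mul_mem (pow_mem omega_mem 2) (hx _)), zero_mem _]
  have hγ (i : Fin 3) : γ i ∈ Eis ω := add_mem (hx _) (mul_mem theta_mem (hβ i))
  have hδ (i : Fin 3) : δ i ∈ Eis ω :=
    sub_mem (add_mem (hs i) (mul_mem theta_mem (hx _))) (mul_mem (ofNat_mem _ 2) (hβ i))
  have hε (i : Fin 3) : ε i ∈ Eis ω := sub_mem (hx _) (hγ i)
  have hφ (i : Fin 3) : φ i ∈ Eis ω :=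
    add_mem (add_mem (sub_mem (hs i) (ht i)) (mul_mem theta_mem (hx _))) (hβ i)
  have key : x = x 12 • Y555vecs ω 0 + ∑ i,
      (β i • Y555vecs ω (armIndex i 0) + γ i • Y555vecs ω (armIndex i 1) +
        δ i • Y555vecs ω (armIndex i 2) + ε i • Y555vecs ω (armIndex i 3) +
        φ i • Y555vecs ω (armIndex i 4)) := by
    have hθ := hσ.theta_mul_self
    have hx₀ (i : Fin 3) : x (blockCoord i 0) = -ε i - theta ω * φ i := by
      simp only [ε, γ, φ]
      linear_combination ht' i - hs' i + x (blockCoord i 2) * hθ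
    have hx₁ (i : Fin 3) : x (blockCoord i 1) = γ i + theta ω * δ i - ε i := by
      simp only [δ, ε, γ]
      linear_combination hs' i - x (blockCoord i 3) * hθ
    have hx₂ (i : Fin 3) : x (blockCoord i 2) = γ i + ε i := by simp only [ε]; ring
    have hx₃ (i : Fin 3) : x (blockCoord i 3) = γ i - theta ω * β i := by simp only [γ]; ring
    have hβ₁₃ : x 13 = x 12 * ω ^ 2 + ∑ i, β i := by
      simp only [β, Finset.sum_pi_single', Finset.mem_univ, if_true]; ring
    clear_value β γ δ ε φ
    refine funext (forall_coord (fun i j => ?_) ?_ ?_)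
    · fin_cases j
      · refine (hx₀ i).trans ?_
        fin_cases i <;> simp [theta, Fin.sum_univ_three, armIndex, blockCoord, Y555vecs] <;> ring
      · refine (hx₁ i).trans ?_
        fin_cases i <;> simp [theta, Fin.sum_univ_three, armIndex, blockCoord, Y555vecs] <;> ring
      · refine (hx₂ i).trans ?_
        fin_cases i <;> simp [Fin.sum_univ_three, armIndex, blockCoord, Y555vecs]
      · refine (hx₃ i).trans ?_
        fin_cases i <;> simp [theta, Fin.sum_univ_three, armIndex, blockCoord, Y555vecs] <;> ring
    · simp [Fin.sum_univ_three, armIndex, Y555vecs]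
    · simpa [Fin.sum_univ_three, armIndex, Y555vecs] using hβ₁₃
  rw [key]
  exact add_mem (hmem _ (hx _)) (sum_mem fun i _ => add_mem (add_mem (add_mem (add_mem
    (hmem _ (hβ i)) (hmem _ (hγ i))) (hmem _ (hδ i))) (hmem _ (hε i)))
    (hmem _ (hφ i)))

theorem mem_LSet_iff_s15 (hσ : IsEisensteinConj ω σ) {x : Fin 14 → K} :
    x ∈ LSet ω ↔ x ∈ latticeY555 ω := by
  rw [latticeY555_eq_span hσ, Submodule.mem_span_range_iff_exists_fun]
  constructor
  · rintro ⟨m, n, rfl⟩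
    exact ⟨fun i => ⟨m i + n i * ω, hσ.mem_eis_iff.2 ⟨m i, n i, rfl⟩⟩, rfl⟩
  · rintro ⟨c, rfl⟩
    choose m n hmn using fun i => hσ.mem_eis_iff.1 (c i).2
    refine ⟨m, n, Finset.sum_congr rfl fun i _ => ?_⟩
    rw [← hmn]
    rfl

theorem isNondegHermitian_innerForm (hσ : IsEisensteinConj ω σ) :
    IsNondegHermitian (innerForm ω σ) where
  conj x y := by
    simp only [innerForm_apply, innerV_eq, map_add, map_neg, map_sum, map_mul, map_sub,
      hσ.map_theta, hσ.map_map, mul_comm]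
    ring
  eq_zero x hx := by
    have hθ := hσ.theta_ne_zero
    refine funext (forall_coord (fun i j => ?_) ?_ ?_)
    · simpa [innerForm_single_blockCoord] using hx (Pi.single (blockCoord i j) 1)
    · simpa [innerForm_single_thirteen, hθ] using hx (Pi.single 13 1)
    · simpa [innerForm_single_twelve, hθ] using hx (Pi.single 12 1)

/-- The form is `θ`-integral on each block of four coordinates. -/
theorem sum_mul_map_mem_thetaIdeal (hσ : IsEisensteinConj ω σ) {x y : Fin 4 → K}
    (hx : ∀ j, x j ∈ Eis ω) (hy : ∀ j, y j ∈ Eis ω)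
    (hx₁ : x 1 + x 2 + x 3 ∈ thetaIdeal ω) (hx₀ : x 0 + x 1 - x 2 ∈ thetaIdeal ω)
    (hy₁ : y 1 + y 2 + y 3 ∈ thetaIdeal ω) (hy₀ : y 0 + y 1 - y 2 ∈ thetaIdeal ω) :
    ∑ j, x j * σ (y j) ∈ thetaIdeal ω := by
  have hy' (j : Fin 4) : σ (y j) ∈ Eis ω := hσ.map_mem (hy j)
  have h₁ := mul_mem_thetaIdeal (hy' 3) hx₁
  have h₀ := mul_mem_thetaIdeal (hy' 0) hx₀
  have h₁' := mul_mem_thetaIdeal (add_mem (hx 1) (hx 2)) (hσ.map_mem_thetaIdeal hy₁)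
  have h₀' := mul_mem_thetaIdeal (sub_mem (hx 2) (hx 1)) (hσ.map_mem_thetaIdeal hy₀)
  have h₃ := mul_mem_thetaIdeal
    (add_mem (mul_mem (hx 1) (hy' 1)) (mul_mem (hx 2) (hy' 2))) hσ.three_mem_thetaIdeal
  convert add_mem (sub_mem (add_mem (add_mem h₁ h₀) h₀') h₁') h₃ using 1
  simp only [Fin.sum_univ_four, map_add, map_sub]
  ring

theorem isThetaModular_latticeY555 (hσ : IsEisensteinConj ω σ) :
    IsThetaModular (innerForm ω σ) (latticeY555 ω) where
  mem_iff x := by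
    constructor
    · rintro ⟨hx, hx'⟩ y ⟨hy, hy'⟩
      rw [innerForm_apply, innerV_eq]
      refine add_mem (neg_mem (sum_mem fun i _ => sum_mul_map_mem_thetaIdeal hσ
        (x := fun j => x (blockCoord i j)) (y := fun j => y (blockCoord i j))
        (fun _ => hx _) (fun _ => hy _) (hx' i).1 (hx' i).2 (hy' i).1 (hy' i).2)) ?_
      rw [mul_comm]
      exact mul_theta_mem (sub_mem (mul_mem (hx _) (hσ.map_mem (hy _)))
        (mul_mem (hx _) (hσ.map_mem (hy _))))
    · intro hx
      have hcancel {e : K} (he : e * theta ω ∈ thetaIdeal ω) : e ∈ Eis ω := by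
        obtain ⟨d, hd, hde⟩ := mem_thetaIdeal.1 he
        exact mul_right_cancel₀ hσ.theta_ne_zero hde ▸ hd
      refine ⟨forall_coord (fun i j => hcancel ?_) (hcancel ?_) (hcancel ?_), fun i => ?_⟩
      · simpa [innerForm_single_blockCoord, hσ.map_theta]
          using hx _ (single_theta_mem (blockCoord i j))
      · simpa [innerForm_single_thirteen, mul_comm]
          using hx _ (single_one_mem (k := 13) (by decide))
      · simpa [innerForm_single_twelve, mul_comm] using hx _ (single_one_mem (k := 12) (by decide))
      · have hc := hx _ (Y555vecs_mem hσ (armIndex i 1))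
        have he := hx _ (Y555vecs_mem hσ (armIndex i 3))
        rw [innerForm_apply, innerV_eq] at hc he
        fin_cases i <;>
        simp [Fin.sum_univ_succ, armIndex, blockCoord, Y555vecs] at hc he ⊢
        all_goals exact ⟨by convert neg_mem hc using 1; ring, by convert he using 1; ring⟩
  full x := by
    choose d hd hd0 hdx using fun j => hσ.exists_mul_mem (x j)
    refine ⟨(∏ j, d j) * theta ω, mul_mem (prod_mem fun j _ => hd j) theta_mem,
      mul_ne_zero (Finset.prod_ne_zero_iff.2 fun j _ => hd0 j) hσ.theta_ne_zero,
      mem_latticeY555_of_forall_mem_thetaIdeal fun j => ?_⟩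
    rw [Pi.smul_apply, smul_eq_mul, ← Finset.prod_erase_mul _ _ (Finset.mem_univ j),
      show ∀ a b c e : K, a * b * c * e = a * (b * e) * c from fun _ _ _ _ => by ring]
    exact mul_theta_mem (mul_mem (prod_mem fun j _ => hd j) (hdx j))

end Y555

/-- The automorphism group of `L` acts transitively on roots: for any
`u, v ∈ L` of norm `-3` there is a `K`-linear automorphism of `V` preserving
the Hermitian form, mapping `L` onto `L`, and sending `u` to `v`. -/
theorem statement15 {K : Type*} [Field K] [CharZero K]
    (ω : K) (hω3 : ω ^ 3 = 1) (hω1 : ω ≠ 1)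
    (hgen : Algebra.adjoin ℚ {ω} = ⊤)
    (σ : K →+* K) (hσ2 : ∀ z : K, σ (σ z) = z) (hσω : σ ω = ω ^ 2)
    (u v : Fin 14 → K) (hu : u ∈ LSet ω) (hv : v ∈ LSet ω)
    (huu : innerV ω σ u u = -3) (hvv : innerV ω σ v v = -3) :
    ∃ g : (Fin 14 → K) ≃ₗ[K] (Fin 14 → K),
      (∀ x y : Fin 14 → K, innerV ω σ (g x) (g y) = innerV ω σ x y) ∧
      g '' LSet ω = LSet ω ∧ g u = v := by
  have hσ : IsEisensteinConj ω σ :=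
    { sq_omega := by
        apply mul_left_cancel₀ (sub_ne_zero.2 hω1)
        linear_combination hω3
      gen := hgen
      map_map := hσ2
      map_omega := hσω }
  have hθ := hσ.theta_mul_self
  obtain ⟨g, hg, hgL, hgu⟩ : ∃ g : (Fin 14 → K) ≃ₗ[K] (Fin 14 → K),
      (∀ x y, innerForm ω σ (g x) (g y) = innerForm ω σ x y) ∧
        (∀ x, g x ∈ latticeY555 ω ↔ x ∈ latticeY555 ω) ∧ g u = v := by
    have htrans {u : Fin 14 → K} (hu : u ∈ LSet ω) (huu : innerV ω σ u u = -3) :=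
      (isThetaModular_latticeY555 hσ).exists_isometry_root
        (latticeY555_eq_span hσ ▸ Submodule.fg_span (Set.finite_range _))
        (isNondegHermitian_innerForm hσ) hσ
        (v := Pi.single (blockCoord 0 0) (theta ω))
        (by rw [innerForm_single_blockCoord, Pi.single_eq_same, hσ.map_theta, mul_neg, neg_neg, hθ])
        isHyperbolicPair_single (single_theta_mem _) (single_one_mem (by decide))
        (single_one_mem (by decide)) ((mem_LSet_iff_s15 hσ).1 hu) huu
    obtain ⟨g, hg, hgL, hgu⟩ := htrans hu huu
    obtain ⟨f, hf, hfL, hfv⟩ := htrans hv hvv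
    refine ⟨g.trans f.symm, fun x y => ?_, fun x => ?_, ?_⟩
    · rw [← hf]; simp [hg]
    · rw [← hfL]; simp [hgL]
    · rw [LinearEquiv.trans_apply, hgu, ← hfv, f.symm_apply_apply]
  refine ⟨g, hg, ?_, hgu⟩
  ext x
  constructor
  · rintro ⟨y, hy, rfl⟩
    exact (mem_LSet_iff_s15 hσ).2 ((hgL y).2 ((mem_LSet_iff_s15 hσ).1 hy))
  · intro hx
    refine ⟨g.symm x, (mem_LSet_iff_s15 hσ).2 ((hgL _).1 ?_), g.apply_symm_apply x⟩
    rwa [g.apply_symm_apply, ← mem_LSet_iff_s15 hσ]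
end

section
/- (Coxeter) The group presented with two generators x, y and relations x y x = y x y, x³ = 1, and y³ = 1 (the Artin group of type A₂ with generators forced to have order 3) is a finite group of order 24. -/
/-- The relators of the Artin group of type `A₂` with generators forced to
have order 3: `xyx(yxy)⁻¹`, `x³`, and `y³`. -/
def A2rels : Set (FreeGroup (Fin 2)) :=
  { FreeGroup.of 0 * FreeGroup.of 1 * FreeGroup.of 0 *
      (FreeGroup.of 1 * FreeGroup.of 0 * FreeGroup.of 1)⁻¹,
    (FreeGroup.of 0) ^ 3, (FreeGroup.of 1) ^ 3 }

section NormalForm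

variable {G : Type*} [Group G] {x y : G}

/-- With `i = x * y ^ 2` and `j = y ^ 2 * x`, the product `x ^ a * i ^ b * j ^ c`. -/
def normalWord (x y : G) (t : Fin 3 × Fin 4 × Fin 2) : G :=
  x ^ (t.1 : ℕ) * (x * y ^ 2) ^ (t.2.1 : ℕ) * (y ^ 2 * x) ^ (t.2.2 : ℕ)

theorem map_normalWord {H : Type*} [Group H] (f : G →* H) (t : Fin 3 × Fin 4 × Fin 2) :
    f (normalWord x y t) = normalWord (f x) (f y) t := by
  simp [normalWord]

/-- The quaternion relations satisfied by `i = x * y ^ 2` and `j = y ^ 2 * x`. -/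
theorem quaternion_relations (hb : x * y * x = y * x * y) (hy : y ^ 3 = 1) :
    (x * y ^ 2) ^ 2 = (y ^ 2 * x) ^ 2 ∧
      (x * y ^ 2) * (y ^ 2 * x) * (x * y ^ 2) = y ^ 2 * x ∧
      (x * y ^ 2) ^ 4 = 1 := by
  have hij : (x * y ^ 2) * (y ^ 2 * x) = x * y * x := by
    calc (x * y ^ 2) * (y ^ 2 * x) = x * y ^ 3 * y * x := by group
      _ = x * y * x := by rw [hy]; group
  have hi : (x * y ^ 2) ^ 2 = (x * y * x) ^ 2 := by
    calc (x * y ^ 2) ^ 2 = x * y * (y * x * y) * y := by simp only [pow_two, mul_assoc]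
      _ = x * y * (x * y * x) * y := by rw [← hb]
      _ = (x * y * x) * (y * x * y) := by simp only [mul_assoc]
      _ = (x * y * x) ^ 2 := by rw [hb, pow_two]
  have hj : (y ^ 2 * x) ^ 2 = (x * y * x) ^ 2 := by
    calc (y ^ 2 * x) ^ 2 = y * (y * x * y) * y * x := by simp only [pow_two, mul_assoc]
      _ = y * (x * y * x) * y * x := by rw [← hb]
      _ = (y * x * y) * (x * y * x) := by simp only [mul_assoc]
      _ = (x * y * x) ^ 2 := by rw [hb, pow_two]
  rw [← hij] at hi hj
  generalize x * y ^ 2 = i at *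
  generalize y ^ 2 * x = j at *
  have hiji : i * j * i = j := by
    apply mul_right_cancel (b := j)
    rw [← pow_two j, hj, pow_two]
    simp only [mul_assoc]
  refine ⟨hi.trans hj.symm, hiji, ?_⟩
  have hcomm : i ^ 2 * j = j * i ^ 2 := by
    rw [hi, ← hj]; group
  apply mul_left_cancel (a := j)
  calc j * i ^ 4 = (j * i ^ 2) * i ^ 2 := by group
    _ = i * (i * j * i) * i := by
        rw [← hcomm]
        simp only [pow_succ, pow_zero, one_mul, mul_assoc]
    _ = j * 1 := by rw [hiji, hiji, mul_one]

theorem zpow_mul_zpow_mul_zpow_mem_range_normalWord (hb : x * y * x = y * x * y)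
    (hx : x ^ 3 = 1) (hy : y ^ 3 = 1) (a b c : ℤ) :
    x ^ a * (x * y ^ 2) ^ b * (y ^ 2 * x) ^ c ∈ Set.range (normalWord x y) := by
  obtain ⟨hsq, -, hi⟩ := quaternion_relations hb hy
  have hmod {g : G} {n : ℕ} (hg : g ^ n = 1) (hn : (n : ℤ) ≠ 0) (m : ℤ) :
      g ^ m = g ^ (m % n).toNat := by
    rw [← zpow_natCast, Int.toNat_of_nonneg (Int.emod_nonneg m hn)]
    exact zpow_eq_zpow_emod' m hg
  have hc : (y ^ 2 * x) ^ c = (x * y ^ 2) ^ (2 * (c / 2)) * (y ^ 2 * x) ^ (c % 2).toNat := by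
    rw [← zpow_natCast (y ^ 2 * x), Int.toNat_of_nonneg (Int.emod_nonneg c two_ne_zero), zpow_mul,
      zpow_ofNat, hsq, ← zpow_ofNat (y ^ 2 * x), ← zpow_mul, ← zpow_add, Int.mul_ediv_add_emod]
  rw [hc, mul_assoc, ← mul_assoc (_ ^ b), ← zpow_add, hmod hx (by norm_num),
    hmod hi (by norm_num), ← mul_assoc]
  exact ⟨(⟨(a % 3).toNat, by omega⟩, ⟨((b + 2 * (c / 2)) % 4).toNat, by omega⟩,
    ⟨(c % 2).toNat, by omega⟩), rfl⟩

theorem mul_normalWord_mem_range (hb : x * y * x = y * x * y)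
    (hx : x ^ 3 = 1) (hy : y ^ 3 = 1) (t : Fin 3 × Fin 4 × Fin 2) :
    x * normalWord x y t ∈ Set.range (normalWord x y) ∧
      (x * y ^ 2) * normalWord x y t ∈ Set.range (normalWord x y) := by
  have hmem := zpow_mul_zpow_mul_zpow_mem_range_normalWord hb hx hy
  obtain ⟨-, hiji, -⟩ := quaternion_relations hb hy
  have hix : (x * y ^ 2) * x = x * (y ^ 2 * x) := by group
  have hjx : (y ^ 2 * x) * x = x * ((x * y ^ 2) * (y ^ 2 * x))⁻¹ := by
    rw [eq_mul_inv_iff_mul_eq]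
    calc y ^ 2 * x * x * (x * y ^ 2 * (y ^ 2 * x)) = y ^ 2 * x ^ 3 * y ^ 3 * (y * x) := by
          simp only [pow_succ, pow_zero, one_mul, mul_assoc]
      _ = x := by rw [hx, mul_one, hy, mul_one, ← mul_assoc, ← pow_succ, hy, one_mul]
  obtain ⟨a, b, c⟩ := t
  simp only [normalWord]
  generalize x * y ^ 2 = i at *
  generalize y ^ 2 * x = j at *
  have hji : SemiconjBy j i i⁻¹ := by
    rw [SemiconjBy, eq_inv_mul_iff_mul_eq, ← mul_assoc, hiji]
  have hjpow (n : ℕ) : j * i ^ n = i ^ (-(n : ℤ)) * j := by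
    simpa using (hji.pow_right n).eq
  have hjinvpow (n : ℤ) : j⁻¹ * i ^ n = i ^ (-n) * j⁻¹ := by
    have := (hji.zpow_right (-n)).eq
    rw [inv_mul_eq_iff_eq_mul, ← mul_assoc, this]
    simp
  constructor
  · convert hmem (1 + a) b c using 1
    simp only [zpow_add, zpow_one, zpow_natCast, mul_assoc]
  · fin_cases a
    · convert hmem 0 (1 + b) c using 1
      simp [zpow_add, mul_assoc]
    · convert hmem 1 (-b) (1 + c) using 1
      calc i * (x ^ 1 * i ^ (b : ℕ) * j ^ (c : ℕ)) = (i * x) * i ^ (b : ℕ) * j ^ (c : ℕ) := by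
            simp only [pow_one, mul_assoc]
        _ = x * (j * i ^ (b : ℕ)) * j ^ (c : ℕ) := by rw [hix]; simp only [mul_assoc]
        _ = _ := by rw [hjpow]; simp [zpow_add, mul_assoc]
    · convert hmem 2 (1 - b) (-1 + c) using 1
      calc i * (x ^ 2 * i ^ (b : ℕ) * j ^ (c : ℕ))
          = (i * x) * x * i ^ (b : ℕ) * j ^ (c : ℕ) := by simp only [pow_two, mul_assoc]
        _ = x * (j * x) * i ^ (b : ℕ) * j ^ (c : ℕ) := by rw [hix]; simp only [mul_assoc]
        _ = x ^ 2 * (j⁻¹ * i ^ ((b : ℤ) - 1)) * j ^ (c : ℕ) := by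
            rw [hjx, sub_eq_neg_add, zpow_add]
            simp only [pow_two, mul_inv_rev, zpow_neg_one, zpow_natCast, mul_assoc]
        _ = _ := by rw [hjinvpow, neg_sub]; simp [zpow_add, mul_assoc]

/-- If `x` and `y` generate `G`, every element is a normal word. -/
theorem normalWord_surjective (hb : x * y * x = y * x * y) (hx : x ^ 3 = 1) (hy : y ^ 3 = 1)
    (hgen : Subgroup.closure {x, y} = ⊤) : Function.Surjective (normalWord x y) := by
  have hxmem (g : G) (hg : g ∈ Set.range (normalWord x y)) :
      x * g ∈ Set.range (normalWord x y) := by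
    obtain ⟨t, rfl⟩ := hg
    exact (mul_normalWord_mem_range hb hx hy t).1
  have himem (g : G) (hg : g ∈ Set.range (normalWord x y)) :
      (x * y ^ 2) * g ∈ Set.range (normalWord x y) := by
    obtain ⟨t, rfl⟩ := hg
    exact (mul_normalWord_mem_range hb hx hy t).2
  have hxinv : x⁻¹ = x * x := by
    rw [inv_eq_iff_mul_eq_one, ← hx]
    simp only [pow_succ, pow_zero, one_mul, mul_assoc]
  have hyinv : y⁻¹ = x * (x * (x * y ^ 2)) := by
    rw [inv_eq_iff_mul_eq_one]
    calc y * (x * (x * (x * y ^ 2))) = y * x ^ 3 * y ^ 2 := by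
          simp only [pow_succ, pow_zero, one_mul, mul_assoc]
      _ = y ^ 3 := by rw [hx]; group
      _ = 1 := hy
  have hyinvmem (g : G) (hg : g ∈ Set.range (normalWord x y)) :
      y⁻¹ * g ∈ Set.range (normalWord x y) := by
    rw [hyinv]
    simpa only [mul_assoc] using hxmem _ (hxmem _ (himem g hg))
  have hyy : y = y⁻¹ * y⁻¹ := by
    rw [eq_inv_mul_iff_mul_eq, eq_inv_iff_mul_eq_one, ← hy]
    simp only [pow_succ, pow_zero, one_mul, mul_assoc]
  intro g
  have hg : g ∈ Subgroup.closure {x, y} := hgen ▸ Subgroup.mem_top g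
  induction hg using Subgroup.closure_induction_left with
  | one => exact ⟨(0, 0, 0), by simp [normalWord]⟩
  | mul_left s hs g _ ih =>
    rcases hs with rfl | rfl
    · exact hxmem g ih
    · have hmem := hyinvmem _ (hyinvmem g ih)
      rwa [← mul_assoc, ← hyy] at hmem
  | inv_mul_cancel s hs g _ ih =>
    rcases hs with rfl | rfl
    · rw [hxinv, mul_assoc]
      exact hxmem _ (hxmem g ih)
    · exact hyinvmem g ih

end NormalForm

/-- The upper and lower elementary transvections in `SL(2, 3)`. -/
def transvections : Fin 2 → Matrix.SpecialLinearGroup (Fin 2) (ZMod 3) :=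
  ![⟨!![1, 1; 0, 1], by decide⟩, ⟨!![1, 0; -1, 1], by decide⟩]

theorem lift_transvections_eq_one :
    ∀ r ∈ A2rels, FreeGroup.lift transvections r = 1 := by
  rintro r (rfl | rfl | rfl)
  · simp only [map_mul, map_inv, FreeGroup.lift_apply_of, mul_inv_eq_one]
    decide
  · simp only [map_pow, FreeGroup.lift_apply_of]
    decide
  · simp only [map_pow, FreeGroup.lift_apply_of]
    decide

theorem normalWord_transvections_injective :
    Function.Injective (normalWord (transvections 0) (transvections 1)) := by
  decide

theorem normalWord_bijective :
    Function.Bijective (normalWord (PresentedGroup.of (rels := A2rels) 0)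
      (PresentedGroup.of (rels := A2rels) 1)) := by
  constructor
  · have h := normalWord_transvections_injective
    have hof (k : Fin 2) : transvections k =
        PresentedGroup.toGroup lift_transvections_eq_one (PresentedGroup.of k) :=
      (PresentedGroup.toGroup.of lift_transvections_eq_one).symm
    rw [hof 0, hof 1] at h
    refine Function.Injective.of_comp
      (f := PresentedGroup.toGroup lift_transvections_eq_one) ?_
    simpa only [Function.comp_def, map_normalWord] using h
  · have hrel {r : FreeGroup (Fin 2)} (hr : r ∈ A2rels) : PresentedGroup.mk A2rels r = 1 :=
      PresentedGroup.one_of_mem hr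
    refine normalWord_surjective ?_ ?_ ?_ ?_
    · exact mul_inv_eq_one.mp (hrel (Or.inl rfl))
    · exact hrel (Or.inr (Or.inl rfl))
    · exact hrel (Or.inr (Or.inr rfl))
    · rw [← PresentedGroup.closure_range_of A2rels]
      congr 1
      ext g
      simp [Fin.exists_fin_two, eq_comm]

/-- (Coxeter) The group presented with two generators `x, y` and relations
`xyx = yxy`, `x³ = 1`, `y³ = 1` (the Artin group of type `A₂` with generators
forced to have order 3) is a finite group of order 24. -/
theorem statement19 :
    Finite (PresentedGroup A2rels) ∧ Nat.card (PresentedGroup A2rels) = 24 := by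
  let e := Equiv.ofBijective _ normalWord_bijective
  exact ⟨Finite.of_equiv _ e, by simp [← Nat.card_congr e]⟩
end
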